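/- arXiv:1411.3582 — 16 statements merged into one kernel-verified Lean document; each statement's English description precedes it below -/
import Mathlib

section
/- Let a < b be real numbers and let f : [a,b] → ℝ be a function. Assume that f admits a finite right-hand limit at each point of [a,b) except on a Lebesgue-negligible set, i.e. the set of points x ∈ [a,b) at which f(y) does not converge to a finite limit as y → x with y > x is Lebesgue-negligible. Then the set of points of [a,b] at which f is not continuous is Lebesgue-negligible. -/
open Set Filter MeasureTheory Topology

/-- The points of `[a,b]` at which the oscillation of `f` relative to `[a,b]` is at least `ε`
are isolated on the right, within the set of all such points, wherever `f` has a right limit. -/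
lemma nhdsWithin_oscillation_inter_Ioi_eq_bot {a b x d ε : ℝ} {f : ℝ → ℝ}
    (hε : 0 < ε) (hd : Tendsto f (𝓝[Ioc x b] x) (𝓝 d)) :
    𝓝[{z ∈ Icc a b | ¬ ∃ U ∈ 𝓝[Icc a b] z, ∀ u ∈ U, ∀ v ∈ U, dist (f u) (f v) < ε} ∩ Ioi x] x
      = ⊥ := by
  obtain ⟨δ, hδ, H⟩ := Metric.tendsto_nhdsWithin_nhds.1 hd (ε / 2) (half_pos hε)
  rw [← empty_mem_iff_bot, mem_nhdsWithin]
  refine ⟨Iio (x + δ), isOpen_Iio, by simpa using hδ, ?_⟩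
  rintro z ⟨hzδ, ⟨-, hz⟩, hxz⟩
  refine hz ⟨Icc a b ∩ Ioo x (x + δ),
    inter_mem_nhdsWithin _ (isOpen_Ioo.mem_nhds ⟨hxz, hzδ⟩), ?_⟩
  have key : ∀ u ∈ Icc a b ∩ Ioo x (x + δ), dist (f u) d < ε / 2 := fun u hu ↦
    H ⟨hu.2.1, hu.1.2⟩ (by rw [Real.dist_eq, abs_lt]; constructor <;> linarith [hu.2.1, hu.2.2])
  intro u hu v hv
  linarith [dist_triangle_right (f u) (f v) d, key u hu, key v hv]

/-- A function whose oscillation relative to `s` at a point of `s` is smaller than every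
`1 / (n + 1)` is continuous there. -/
lemma continuousWithinAt_of_forall_oscillation_lt {s : Set ℝ} {x : ℝ} {f : ℝ → ℝ} (hx : x ∈ s)
    (H : ∀ n : ℕ, ∃ U ∈ 𝓝[s] x, ∀ u ∈ U, ∀ v ∈ U, dist (f u) (f v) < 1 / ((n : ℝ) + 1)) :
    ContinuousWithinAt f s x := by
  refine Metric.tendsto_nhds.2 fun ε hε ↦ ?_
  obtain ⟨n, hn⟩ := exists_nat_one_div_lt hε
  obtain ⟨U, hU, h⟩ := H n
  filter_upwards [hU] with u hu
  exact (h u hu x (mem_of_mem_nhdsWithin hx hU)).trans hn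

/-- If `f : [a,b] → ℝ` admits a finite right-hand limit at each point of
`[a,b)` except on a Lebesgue-negligible set, then the set of points of `[a,b]` at which
`f` is not continuous (relative to `[a,b]`) is Lebesgue-negligible. -/
theorem ae_continuous_of_right_limits_ae (a b : ℝ) (hab : a < b) (f : ℝ → ℝ)
    (h : volume {x ∈ Set.Ico a b |
        ¬ ∃ d : ℝ, Tendsto f (𝓝[Set.Ioc x b] x) (𝓝 d)} = 0) :
    volume {x ∈ Set.Icc a b | ¬ ContinuousWithinAt f (Set.Icc a b) x} = 0 := by
  let D : ℕ → Set ℝ := fun n ↦ {z ∈ Icc a b |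
    ¬ ∃ U ∈ 𝓝[Icc a b] z, ∀ u ∈ U, ∀ v ∈ U, dist (f u) (f v) < 1 / ((n : ℝ) + 1)}
  have hD : (⋃ n, {x ∈ D n | 𝓝[D n ∩ Ioi x] x = ⊥}).Countable :=
    countable_iUnion fun n ↦ countable_setOfPred_isolated_right_within
  refine measure_mono_null ?_ (measure_union_null h
    (measure_union_null (measure_singleton b) (hD.measure_zero volume)))
  rintro x ⟨hx, hfx⟩
  obtain rfl | hxb := hx.2.eq_or_lt
  · exact .inr (.inl rfl)
  by_cases hd : ∃ d : ℝ, Tendsto f (𝓝[Ioc x b] x) (𝓝 d)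
  · obtain ⟨d, hd⟩ := hd
    obtain ⟨n, hn⟩ := not_forall.1 (mt (continuousWithinAt_of_forall_oscillation_lt hx) hfx)
    exact .inr (.inr (mem_iUnion.2 ⟨n, ⟨hx, hn⟩,
      nhdsWithin_oscillation_inter_Ioi_eq_bot Nat.one_div_pos_of_nat hd⟩))
  · exact .inl ⟨⟨hx.1, hxb⟩, hd⟩
end

section
/- Let a < b be real numbers and let f : [a,b] → ℝ be a function. Assume that f admits a finite right-hand limit at each point of [a,b) except on an at most countable set, i.e. the set of points x ∈ [a,b) at which f(y) does not converge to a finite limit as y → x with y > x is at most countable. Then the set of points of [a,b] at which f is not continuous is at most countable. -/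
open Set Filter MeasureTheory Topology

/-- The points of `s` at which the oscillation of `f` relative to `s` is at least `ε`. -/
def largeOscillationSet (f : ℝ → ℝ) (s : Set ℝ) (ε : ℝ) : Set ℝ :=
  {x | x ∈ s ∧ ¬ ∀ᶠ p in 𝓝[s] x ×ˢ 𝓝[s] x, dist (f p.1) (f p.2) < ε}

theorem exists_mem_largeOscillationSet {f : ℝ → ℝ} {s : Set ℝ} {x : ℝ} (hx : x ∈ s)
    (hf : ¬ ContinuousWithinAt f s x) :
    ∃ n : ℕ, x ∈ largeOscillationSet f s (1 / ((n : ℝ) + 1)) := by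
  by_contra! hn
  refine hf (Metric.tendsto_nhds.2 fun ε hε => ?_)
  obtain ⟨n, hnε⟩ := exists_nat_one_div_lt hε
  have hosc : ∀ᶠ p in 𝓝[s] x ×ˢ 𝓝[s] x, dist (f p.1) (f p.2) < 1 / ((n : ℝ) + 1) := by
    by_contra hc
    exact hn n ⟨hx, hc⟩
  filter_upwards [hosc.curry] with y hy
  exact (hy.self_of_nhdsWithin hx).trans hnε

/-- A right-hand limit of `f` at `x` isolates `x` from the right in the set of points of
oscillation at least `ε`. -/
theorem nhdsWithin_largeOscillationSet_inter_Ioi_eq_bot {f : ℝ → ℝ} {a b x d ε : ℝ}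
    (hε : 0 < ε) (hxb : x < b) (hd : Tendsto f (𝓝[Ioc x b] x) (𝓝 d)) :
    𝓝[largeOscillationSet f (Icc a b) ε ∩ Ioi x] x = ⊥ := by
  rw [nhdsWithin_Ioc_eq_nhdsGT hxb] at hd
  obtain ⟨c, hxc, hc⟩ := (mem_nhdsGT_iff_exists_Ioo_subset).1
    (Metric.tendsto_nhds.1 hd (ε / 2) (half_pos hε))
  rw [← empty_mem_iff_bot, mem_nhdsWithin]
  refine ⟨Iio c, isOpen_Iio, hxc, ?_⟩
  rintro y ⟨hyc, ⟨-, hy⟩, hxy⟩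
  have hnear : ∀ᶠ u in 𝓝[Icc a b] y, dist (f u) d < ε / 2 :=
    mem_nhdsWithin_of_mem_nhds (mem_of_superset (Ioo_mem_nhds hxy hyc) hc)
  refine hy ?_
  filter_upwards [hnear.prod_mk hnear] with p hp
  linarith [dist_triangle_right (f p.1) (f p.2) d, hp.1, hp.2]

/-- If `f : [a,b] → ℝ` admits a finite right-hand limit at each point of
`[a,b)` except on an at most countable set, then the set of points of `[a,b]` at which
`f` is not continuous (relative to `[a,b]`) is at most countable. -/
theorem countable_discontinuities_of_right_limits_off_countable (a b : ℝ) (hab : a < b)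
    (f : ℝ → ℝ)
    (h : {x ∈ Set.Ico a b |
        ¬ ∃ d : ℝ, Tendsto f (𝓝[Set.Ioc x b] x) (𝓝 d)}.Countable) :
    {x ∈ Set.Icc a b | ¬ ContinuousWithinAt f (Set.Icc a b) x}.Countable := by
  have hosc (n : ℕ) : (largeOscillationSet f (Icc a b) (1 / ((n : ℝ) + 1))).Countable := by
    refine ((h.union (countable_singleton b)).union
      (countable_setOfPred_isolated_right_within
        (s := largeOscillationSet f (Icc a b) (1 / ((n : ℝ) + 1))))).mono fun x hx => ?_
    rcases hx.1.2.eq_or_lt with hxb | hxb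
    · exact Or.inl (Or.inr hxb)
    by_cases hd : ∃ d : ℝ, Tendsto f (𝓝[Set.Ioc x b] x) (𝓝 d)
    · obtain ⟨d, hd⟩ := hd
      exact Or.inr ⟨hx, nhdsWithin_largeOscillationSet_inter_Ioi_eq_bot
        Nat.one_div_pos_of_nat hxb hd⟩
    · exact Or.inl (Or.inl ⟨⟨hx.1.1, hxb⟩, hd⟩)
  refine (countable_iUnion hosc).mono fun x hx => ?_
  exact mem_iUnion.2 (exists_mem_largeOscillationSet hx.1 hx.2)
end

section
/- Let a < b be real numbers, f : [a,b] → ℝ a function, and z ∈ (a,b]. Assume that f admits a finite left-hand limit at z. Then for every ε > 0 there exists ν > 0 such that for every x ∈ [z−ν, z) ∩ [a,b], the right-hand oscillation of f at x satisfies ω_R(x) ≤ ε. -/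
open Set Filter MeasureTheory Topology

/-- The right-hand oscillation of `f` at `x` relative to the domain `[a,b]`:
`ω_R(x) = lim_{h→0+} (sup_{y ∈ [x,x+h] ∩ [a,b]} f y) - lim_{h→0+} (inf_{y ∈ [x,x+h] ∩ [a,b]} f y)`,
computed in `EReal`.  Since the supremum over `[x,x+h]` is nondecreasing in `h`, its limit as
`h → 0+` is the infimum over `h > 0`; similarly the limit of the infima is the supremum over
`h > 0`. -/
noncomputable def oscR (a b : ℝ) (f : ℝ → ℝ) (x : ℝ) : EReal :=
  (⨅ h ∈ Set.Ioi (0 : ℝ), ⨆ y ∈ Set.Icc x (x + h) ∩ Set.Icc a b, (f y : EReal)) -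
  (⨆ h ∈ Set.Ioi (0 : ℝ), ⨅ y ∈ Set.Icc x (x + h) ∩ Set.Icc a b, (f y : EReal))

/-- If `f` takes values in `[m, M]` on `[x, x + h] ∩ [a, b]` for some `h > 0`, then its right-hand
oscillation at `x` is at most `M - m`. -/
theorem oscR_le_sub_of_forall_mem_Icc {a b x h m M : ℝ} {f : ℝ → ℝ} (hh : 0 < h)
    (hf : ∀ y ∈ Set.Icc x (x + h) ∩ Set.Icc a b, f y ∈ Set.Icc m M) :
    oscR a b f x ≤ ((M - m : ℝ) : EReal) := by
  rw [EReal.coe_sub]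
  refine EReal.sub_le_sub (iInf₂_le_of_le h hh ?_) (le_iSup₂_of_le h hh ?_)
  · exact iSup₂_le fun y hy => EReal.coe_le_coe_iff.2 (hf y hy).2
  · exact le_iInf₂ fun y hy => EReal.coe_le_coe_iff.2 (hf y hy).1

/-- If `f : [a,b] → ℝ` admits a finite left-hand limit at `z ∈ (a,b]`, then for
every `ε > 0` there is `ν > 0` such that `ω_R(x) ≤ ε` for every `x ∈ [z-ν, z) ∩ [a,b]`. -/
theorem oscR_le_of_left_limit (a b : ℝ) (hab : a < b) (f : ℝ → ℝ) (z : ℝ)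
    (hz : z ∈ Set.Ioc a b)
    (hlim : ∃ d : ℝ, Tendsto f (𝓝[Set.Ico a z] z) (𝓝 d)) :
    ∀ ε : ℝ, 0 < ε → ∃ ν : ℝ, 0 < ν ∧
      ∀ x ∈ Set.Ico (z - ν) z ∩ Set.Icc a b, oscR a b f x ≤ (ε : EReal) := by
  obtain ⟨d, hd⟩ := hlim
  intro ε hε
  obtain ⟨δ, hδ, hf⟩ := Metric.tendsto_nhdsWithin_nhds.1 hd (ε / 2) (half_pos hε)
  refine ⟨δ / 2, half_pos hδ, ?_⟩
  rintro x ⟨⟨hx, hxz⟩, -⟩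
  have key : oscR a b f x ≤ (((d + ε / 2) - (d - ε / 2) : ℝ) : EReal) := by
    refine oscR_le_sub_of_forall_mem_Icc (h := (z - x) / 2) (by linarith) ?_
    rintro y ⟨⟨hxy, hyx⟩, hay, -⟩
    have hyz : y < z := by linarith
    have hdist : dist y z < δ := by
      rw [Real.dist_eq, abs_lt]
      constructor <;> linarith
    have hfy := hf ⟨hay, hyz⟩ hdist
    rw [Real.dist_eq, abs_lt] at hfy
    constructor <;> linarith
  rwa [add_sub_sub_cancel, add_halves] at key
end

section
/- Let a < b be real numbers, f : [a,b] → ℝ a function, and N a Lebesgue-negligible subset of [a,b]. Assume that f admits a finite right-hand limit at each x ∈ [a,b) \ N. Then the set of points of (a,b] at which f is not left-hand continuous is Lebesgue-negligible. -/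
open Set Filter MeasureTheory Topology

/-- The points of `(a,b]` at which every left neighbourhood contains a point where `f` differs
from its value by at least `ε`. -/
def leftJumpSet (a b : ℝ) (f : ℝ → ℝ) (ε : ℝ) : Set ℝ :=
  {y ∈ Ioc a b | ¬ ∀ᶠ z in 𝓝[Icc a y] y, dist (f z) (f y) < ε}

theorem nhdsWithin_leftJumpSet_inter_Ioi_eq_bot {a b x d ε : ℝ} {f : ℝ → ℝ} (hxb : x < b)
    (hε : 0 < ε) (hd : Tendsto f (𝓝[Ioc x b] x) (𝓝 d)) :
    𝓝[leftJumpSet a b f ε ∩ Ioi x] x = ⊥ := by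
  rw [nhdsWithin_Ioc_eq_nhdsGT hxb] at hd
  have hev : ∀ᶠ y in 𝓝[>] x, dist (f y) d < ε / 2 :=
    hd (Metric.ball_mem_nhds d (half_pos hε))
  obtain ⟨c, hc, hsub⟩ := mem_nhdsGT_iff_exists_Ioo_subset.1 hev
  refine empty_mem_iff_bot.1 (mem_nhdsWithin.2 ⟨Iio c, isOpen_Iio, hc, ?_⟩)
  rintro y ⟨hyc', ⟨-, hy⟩, hxy⟩
  have hyc : y ∈ Ioo x c := ⟨hxy, hyc'⟩
  refine hy (mem_nhdsWithin_of_mem_nhds ?_)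
  filter_upwards [Ioo_mem_nhds hyc.1 hyc.2] with z hz
  have hz' : dist (f z) d < ε / 2 := hsub hz
  have hy' : dist (f y) d < ε / 2 := hsub hyc
  linarith [dist_triangle_right (f z) (f y) d]

theorem volume_leftJumpSet_eq_zero {a b ε : ℝ} {f : ℝ → ℝ} {N : Set ℝ} (hε : 0 < ε)
    (hN : volume N = 0)
    (hlim : ∀ x ∈ Ico a b \ N, ∃ d : ℝ, Tendsto f (𝓝[Ioc x b] x) (𝓝 d)) :
    volume (leftJumpSet a b f ε) = 0 := by
  have hcount := countable_setOfPred_isolated_right_within (s := leftJumpSet a b f ε)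
  refine measure_mono_null ?_
    (measure_union_null (measure_union_null hN (measure_singleton b)) (hcount.measure_zero volume))
  intro x hx
  by_cases hxN : x ∈ N
  · exact Or.inl (Or.inl hxN)
  rcases hx.1.2.eq_or_lt with rfl | hxb
  · exact Or.inl (Or.inr rfl)
  obtain ⟨d, hd⟩ := hlim x ⟨⟨hx.1.1.le, hxb⟩, hxN⟩
  exact Or.inr ⟨hx, nhdsWithin_leftJumpSet_inter_Ioi_eq_bot hxb hε hd⟩

/-- If `N ⊆ [a,b]` is Lebesgue-negligible and `f : [a,b] → ℝ` admits a finite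
right-hand limit at each `x ∈ [a,b) \ N`, then the set of points of `(a,b]` at which `f` is
not left-hand continuous is Lebesgue-negligible. -/
theorem left_continuity_ae_of_right_limits (a b : ℝ) (hab : a < b) (f : ℝ → ℝ)
    (N : Set ℝ) (hNsub : N ⊆ Set.Icc a b) (hN : volume N = 0)
    (hlim : ∀ x ∈ Set.Ico a b \ N, ∃ d : ℝ, Tendsto f (𝓝[Set.Ioc x b] x) (𝓝 d)) :
    volume {x ∈ Set.Ioc a b | ¬ ContinuousWithinAt f (Set.Icc a x) x} = 0 := by
  refine measure_mono_null ?_ (measure_iUnion_null fun n : ℕ =>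
    volume_leftJumpSet_eq_zero (Nat.one_div_pos_of_nat (n := n)) hN hlim)
  rintro x ⟨hx, hcont⟩
  by_contra hnot
  refine hcont (Metric.tendsto_nhds.2 fun ε hε => ?_)
  obtain ⟨n, hn⟩ := exists_nat_one_div_lt hε
  have hx' : ∀ᶠ z in 𝓝[Icc a x] x, dist (f z) (f x) < 1 / ((n : ℝ) + 1) := by
    by_contra h
    exact hnot (mem_iUnion.2 ⟨n, hx, h⟩)
  exact hx'.mono fun z hz => hz.trans hn
end

section
/- Let a < b be real numbers, f : [a,b] → ℝ a function, and N an at most countable subset of [a,b]. Assume that f admits a finite right-hand limit at each x ∈ [a,b) \ N. Then the set of points of (a,b] at which f is not left-hand continuous is at most countable. -/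
open Set Filter MeasureTheory Topology

/-- A set of reals all of whose points, outside a countable set, are isolated from the right
is countable. -/
theorem countable_of_forall_exists_disjoint_Ioo {A C : Set ℝ} (hC : C.Countable)
    (h : ∀ x ∈ A \ C, ∃ u > x, Disjoint A (Ioo x u)) : A.Countable := by
  refine (hC.union (countable_setOfPred_isolated_right_within (s := A))).mono fun x hx => ?_
  by_cases hxC : x ∈ C
  · exact Or.inl hxC
  · obtain ⟨u, hu, hd⟩ := h x ⟨hx, hxC⟩
    refine Or.inr ⟨hx, empty_mem_iff_bot.1 (mem_nhdsWithin.2 ⟨Iio u, isOpen_Iio, hu, ?_⟩)⟩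
    exact fun z hz => disjoint_left.1 hd hz.2.1 ⟨hz.2.2, hz.1⟩

/-- If `N ⊆ [a,b]` is at most countable and `f : [a,b] → ℝ` admits a finite
right-hand limit at each `x ∈ [a,b) \ N`, then the set of points of `(a,b]` at which `f` is
not left-hand continuous is at most countable. -/
theorem left_continuity_countable_of_right_limits (a b : ℝ) (hab : a < b) (f : ℝ → ℝ)
    (N : Set ℝ) (hNsub : N ⊆ Set.Icc a b) (hN : N.Countable)
    (hlim : ∀ x ∈ Set.Ico a b \ N, ∃ d : ℝ, Tendsto f (𝓝[Set.Ioc x b] x) (𝓝 d)) :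
    {x ∈ Set.Ioc a b | ¬ ContinuousWithinAt f (Set.Icc a x) x}.Countable := by
  let A (n : ℕ) : Set ℝ := {x ∈ Ioc a b | ∀ δ > 0, ∃ y ∈ Icc a x,
    dist y x < δ ∧ 1 / ((n : ℝ) + 1) ≤ dist (f y) (f x)}
  have hA (n : ℕ) : (A n).Countable := by
    refine countable_of_forall_exists_disjoint_Ioo (hN.insert b) ?_
    rintro x ⟨⟨hx, -⟩, hxN⟩
    rw [mem_insert_iff, not_or] at hxN
    have hxb : x < b := lt_of_le_of_ne hx.2 hxN.1
    obtain ⟨d, hd⟩ := hlim x ⟨⟨hx.1.le, hxb⟩, hxN.2⟩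
    have hpos : 0 < 1 / ((n : ℝ) + 1) / 2 := by positivity
    obtain ⟨r, hr, hclose⟩ := Metric.tendsto_nhdsWithin_nhds.1 hd _ hpos
    have hball {w : ℝ} (hw : w ∈ Ioo x (min b (x + r))) :
        dist (f w) d < 1 / ((n : ℝ) + 1) / 2 := by
      obtain ⟨hxw, hwu⟩ := hw
      obtain ⟨hwb, hwr⟩ := lt_min_iff.1 hwu
      exact hclose ⟨hxw, hwb.le⟩ (by rw [Real.dist_eq, abs_of_pos] <;> linarith)
    refine ⟨min b (x + r), lt_min hxb (by linarith), disjoint_left.2 fun z hzA hz => ?_⟩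
    obtain ⟨y, hy, hyz, hfar⟩ := hzA.2 (z - x) (sub_pos.2 hz.1)
    rw [Real.dist_eq, abs_lt] at hyz
    have hyu := hball ⟨by linarith [hyz.1], hy.2.trans_lt hz.2⟩
    linarith [hball hz, dist_triangle_right (f y) (f z) d]
  refine (countable_iUnion hA).mono ?_
  rintro x ⟨hx, hfx⟩
  rw [Metric.continuousWithinAt_iff] at hfx
  push Not at hfx
  obtain ⟨ε, hε, hfar⟩ := hfx
  obtain ⟨n, hn⟩ := exists_nat_one_div_lt hε
  refine mem_iUnion.2 ⟨n, hx, fun δ hδ => ?_⟩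
  obtain ⟨y, hy, hyx, hfy⟩ := hfar δ hδ
  exact ⟨y, hy, hyx, hn.le.trans hfy⟩
end

section
/- Let a < b be real numbers, f : [a,b] → ℝ a function, and M a Lebesgue-negligible subset of [a,b]. Assume that f admits a finite left-hand limit at each x ∈ (a,b] \ M. Then the set of points of [a,b) at which f is not right-hand continuous is Lebesgue-negligible. -/
open Set Filter MeasureTheory Topology

/-- To the left of a point at which `f` has a left-hand limit, the local oscillation of `f` is
small. -/
lemma eventually_nhdsLT_eventually_dist_lt {f : ℝ → ℝ} {x d ε : ℝ}
    (h : Tendsto f (𝓝[<] x) (𝓝 d)) (hε : 0 < ε) :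
    ∀ᶠ z in 𝓝[<] x, ∀ᶠ y in 𝓝 z, dist (f y) (f z) < ε := by
  have h₁ : ∀ᶠ z in 𝓝[<] x, dist (f z) d < ε / 2 :=
    h.eventually (Metric.ball_mem_nhds d (half_pos hε))
  filter_upwards [h₁, eventually_eventually_nhdsWithin.2 h₁, self_mem_nhdsWithin] with z hz hy hzx
  rw [isOpen_Iio.nhdsWithin_eq hzx] at hy
  filter_upwards [hy] with y hy
  linarith [dist_triangle_right (f y) (f z) d]

/-- If `f` has a left-hand limit at each point of `s`, then only countably many points of `s`
are points of discontinuity at which the oscillation of `f` is at least `ε`. -/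
lemma countable_not_eventually_dist_lt {f : ℝ → ℝ} {s : Set ℝ} {ε : ℝ} (hε : 0 < ε)
    (h : ∀ x ∈ s, ∃ d, Tendsto f (𝓝[<] x) (𝓝 d)) :
    {x ∈ s | ¬ ∀ᶠ y in 𝓝 x, dist (f y) (f x) < ε}.Countable := by
  set t := {x ∈ s | ¬ ∀ᶠ y in 𝓝 x, dist (f y) (f x) < ε}
  refine (countable_setOfPred_isolated_left_within (s := t)).mono ?_
  intro x hx
  refine ⟨hx, ?_⟩
  obtain ⟨d, hd⟩ := h x hx.1
  have key := eventually_nhdsLT_eventually_dist_lt hd hε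
  rw [eventually_nhdsWithin_iff] at key
  rw [← eventually_false_iff_eq_bot, eventually_nhdsWithin_iff]
  filter_upwards [key] with z hz hzt
  exact hzt.1.2 (hz hzt.2)

/-- If `f` has a left-hand limit at each point of `s`, then `f` is continuous at all but countably
many points of `s`. -/
lemma countable_not_continuousAt_of_tendsto_nhdsLT {f : ℝ → ℝ} {s : Set ℝ}
    (h : ∀ x ∈ s, ∃ d, Tendsto f (𝓝[<] x) (𝓝 d)) :
    {x ∈ s | ¬ ContinuousAt f x}.Countable := by
  refine (countable_iUnion fun n : ℕ ↦
    countable_not_eventually_dist_lt (Nat.one_div_pos_of_nat (α := ℝ) (n := n)) h).mono ?_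
  rintro x ⟨hxs, hx⟩
  by_contra hcon
  simp only [mem_iUnion, not_exists] at hcon
  refine hx (Metric.tendsto_nhds.2 fun ε hε ↦ ?_)
  obtain ⟨n, hn⟩ := exists_nat_one_div_lt hε
  have := not_not.1 fun hne ↦ hcon n ⟨hxs, hne⟩
  exact this.mono fun y hy ↦ hy.trans hn

/-- If `M ⊆ [a,b]` is Lebesgue-negligible and `f : [a,b] → ℝ` admits a finite
left-hand limit at each `x ∈ (a,b] \ M`, then the set of points of `[a,b)` at which `f` is
not right-hand continuous is Lebesgue-negligible. -/
theorem right_continuity_ae_of_left_limits (a b : ℝ) (hab : a < b) (f : ℝ → ℝ)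
    (M : Set ℝ) (hMsub : M ⊆ Set.Icc a b) (hM : volume M = 0)
    (hlim : ∀ x ∈ Set.Ioc a b \ M, ∃ d : ℝ, Tendsto f (𝓝[Set.Ico a x] x) (𝓝 d)) :
    volume {x ∈ Set.Ico a b | ¬ ContinuousWithinAt f (Set.Icc x b) x} = 0 := by
  have hcount : {x ∈ Ioc a b \ M | ¬ ContinuousAt f x}.Countable := by
    refine countable_not_continuousAt_of_tendsto_nhdsLT fun x hx ↦ ?_
    obtain ⟨d, hd⟩ := hlim x hx
    exact ⟨d, by rwa [nhdsWithin_Ico_eq_nhdsLT hx.1.1] at hd⟩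
  refine measure_mono_null ?_
    (measure_union_null hM ((hcount.insert a).measure_zero volume))
  rintro x ⟨hx, hfx⟩
  by_cases hxM : x ∈ M
  · exact Or.inl hxM
  rcases hx.1.eq_or_lt with rfl | hax
  · exact Or.inr (mem_insert _ _)
  · exact Or.inr (mem_insert_of_mem _
      ⟨⟨⟨hax, hx.2.le⟩, hxM⟩, fun hc ↦ hfx hc.continuousWithinAt⟩)
end

section
/- Let a < b be real numbers, f : [a,b] → ℝ a function, and M an at most countable subset of [a,b]. Assume that f admits a finite left-hand limit at each x ∈ (a,b] \ M. Then the set of points of [a,b) at which f is not right-hand continuous is at most countable. -/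
open Set Filter MeasureTheory Topology

/-- If the left limit of `f` at `x` along `[a, x)` exists, then `x` is isolated on the left in the
set of points where `f` frequently oscillates by at least `ε` on the right. -/
lemma nhdsWithin_frequently_le_dist_inter_Iio_eq_bot {a b x d ε : ℝ} {f : ℝ → ℝ} (hε : 0 < ε)
    (hx : a < x) (hd : Tendsto f (𝓝[Ico a x] x) (𝓝 d)) :
    𝓝[{w ∈ Ico a b | ∃ᶠ y in 𝓝[Icc w b] w, ε ≤ dist (f y) (f w)} ∩ Iio x] x = ⊥ := by
  have hball : f ⁻¹' Metric.ball d (ε / 2) ∈ 𝓝[Ico a x] x :=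
    hd (Metric.ball_mem_nhds d (half_pos hε))
  rw [nhdsWithin_Ico_eq_nhdsLT hx, mem_nhdsLT_iff_exists_mem_Ico_Ioo_subset hx] at hball
  obtain ⟨l, ⟨-, hlx⟩, hl⟩ := hball
  rw [← empty_mem_iff_bot, mem_nhdsWithin]
  refine ⟨Ioi l, isOpen_Ioi, hlx, ?_⟩
  rintro w ⟨hlw, ⟨-, hw⟩, hwx⟩
  have hnear : ∀ᶠ y in 𝓝[Icc w b] w, y ∈ Ioo l x :=
    mem_nhdsWithin_of_mem_nhds (Ioo_mem_nhds hlw hwx)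
  obtain ⟨y, hy, hyx⟩ := (hw.and_eventually hnear).exists
  have hyd : dist (f y) d < ε / 2 := hl hyx
  have hwd : dist (f w) d < ε / 2 := hl ⟨hlw, hwx⟩
  linarith [dist_triangle_right (f y) (f w) d]

/-- If `M ⊆ [a,b]` is at most countable and `f : [a,b] → ℝ` admits a finite
left-hand limit at each `x ∈ (a,b] \ M`, then the set of points of `[a,b)` at which `f` is
not right-hand continuous is at most countable. -/
theorem right_continuity_countable_of_left_limits (a b : ℝ) (hab : a < b) (f : ℝ → ℝ)
    (M : Set ℝ) (hMsub : M ⊆ Set.Icc a b) (hM : M.Countable)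
    (hlim : ∀ x ∈ Set.Ioc a b \ M, ∃ d : ℝ, Tendsto f (𝓝[Set.Ico a x] x) (𝓝 d)) :
    {x ∈ Set.Ico a b | ¬ ContinuousWithinAt f (Set.Icc x b) x}.Countable := by
  let S (ε : ℝ) : Set ℝ := {w ∈ Ico a b | ∃ᶠ y in 𝓝[Icc w b] w, ε ≤ dist (f y) (f w)}
  have hS (ε : ℝ) (hε : 0 < ε) : (S ε).Countable := by
    refine ((hM.insert a).union (countable_setOfPred_isolated_left_within (s := S ε))).mono ?_
    intro x hx
    by_cases hxM : x ∈ insert a M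
    · exact Or.inl hxM
    · rw [mem_insert_iff, not_or] at hxM
      have hax : a < x := lt_of_le_of_ne hx.1.1 (Ne.symm hxM.1)
      obtain ⟨d, hd⟩ := hlim x ⟨⟨hax, hx.1.2.le⟩, hxM.2⟩
      exact Or.inr ⟨hx, nhdsWithin_frequently_le_dist_inter_Iio_eq_bot hε hax hd⟩
  refine (countable_iUnion fun n : ℕ => hS (1 / (n + 1)) Nat.one_div_pos_of_nat).mono ?_
  rintro x ⟨hx, hfx⟩
  rw [ContinuousWithinAt, Metric.tendsto_nhds] at hfx
  push Not at hfx
  obtain ⟨ε, hε, hfreq⟩ := hfx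
  obtain ⟨n, hn⟩ := exists_nat_one_div_lt hε
  exact mem_iUnion.2 ⟨n, hx, hfreq.mono fun y hy => hn.le.trans hy⟩
end

section
/- Let a < b be real numbers and f : [a,b] → ℝ a function. Then the set of discontinuity points of f is Lebesgue-negligible if and only if the set of points of (a,b] at which f is not left-hand continuous is Lebesgue-negligible. -/
open Set Filter MeasureTheory Topology

/-- The points at which a function is left-continuous but has oscillation at least `ε` are
isolated on the left, hence there are only countably many of them. -/
theorem countable_leftContinuous_of_large_oscillation (f : ℝ → ℝ) (D : Set ℝ) {ε : ℝ}
    (hε : 0 < ε) :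
    {x | x ∈ D ∧ ContinuousWithinAt f (D ∩ Iic x) x ∧
      ∀ U ∈ 𝓝 x, ∃ y ∈ U ∩ D, ∃ z ∈ U ∩ D, ε ≤ dist (f y) (f z)}.Countable := by
  refine Countable.mono ?_ (countable_setOfPred_isolated_left_within (s := {x | x ∈ D ∧
    ContinuousWithinAt f (D ∩ Iic x) x ∧
      ∀ U ∈ 𝓝 x, ∃ y ∈ U ∩ D, ∃ z ∈ U ∩ D, ε ≤ dist (f y) (f z)}))
  intro x hx
  refine ⟨hx, ?_⟩
  obtain ⟨-, hleft, -⟩ := hx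
  obtain ⟨δ, hδ, hball⟩ := Metric.continuousWithinAt_iff.1 hleft (ε / 2) (half_pos hε)
  rw [← empty_mem_iff_bot, mem_nhdsWithin]
  refine ⟨Metric.ball x δ, Metric.isOpen_ball, Metric.mem_ball_self hδ, ?_⟩
  rintro w ⟨hw, ⟨-, -, hosc⟩, hwx⟩
  obtain ⟨y, ⟨⟨hy, hyx⟩, hyD⟩, z, ⟨⟨hz, hzx⟩, hzD⟩, hyz⟩ :=
    hosc (Metric.ball x δ ∩ Iio x) ((Metric.isOpen_ball.inter isOpen_Iio).mem_nhds ⟨hw, hwx⟩)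
  have hy' := hball ⟨hyD, Iio_subset_Iic_self hyx⟩ hy
  have hz' := hball ⟨hzD, Iio_subset_Iic_self hzx⟩ hz
  have := dist_triangle_right (f y) (f z) (f x)
  exact absurd hyz (by linarith)

/-- A function on a set of reals is continuous at all but countably many of the points at which it
is left-continuous. -/
theorem countable_leftContinuous_not_continuous (f : ℝ → ℝ) (D : Set ℝ) :
    {x | x ∈ D ∧ ContinuousWithinAt f (D ∩ Iic x) x ∧ ¬ ContinuousWithinAt f D x}.Countable := by
  refine (countable_iUnion fun n : ℕ ↦ countable_leftContinuous_of_large_oscillation f D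
    (Nat.one_div_pos_of_nat (α := ℝ) (n := n))).mono ?_
  rintro x ⟨hxD, hleft, hx⟩
  rw [Metric.continuousWithinAt_iff'] at hx
  push Not at hx
  obtain ⟨ε, hε, hfreq⟩ := hx
  obtain ⟨n, hn⟩ := exists_nat_one_div_lt hε
  refine mem_iUnion.2 ⟨n, hxD, hleft, fun U hU ↦ ?_⟩
  obtain ⟨y, hy, hyU, hyD⟩ :=
    (hfreq.and_eventually (inter_mem (mem_nhdsWithin_of_mem_nhds hU) self_mem_nhdsWithin)).exists
  exact ⟨y, ⟨hyU, hyD⟩, x, ⟨mem_of_mem_nhds hU, hxD⟩, hn.le.trans hy⟩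

/-- For `f : [a,b] → ℝ`, the set of discontinuity points of `f` is
Lebesgue-negligible iff the set of points of `(a,b]` at which `f` is not left-hand continuous
is Lebesgue-negligible. -/
theorem ae_continuous_iff_ae_left_continuous (a b : ℝ) (hab : a < b) (f : ℝ → ℝ) :
    volume {x ∈ Set.Icc a b | ¬ ContinuousWithinAt f (Set.Icc a b) x} = 0 ↔
    volume {x ∈ Set.Ioc a b | ¬ ContinuousWithinAt f (Set.Icc a x) x} = 0 := by
  constructor
  · refine measure_mono_null fun x ⟨hx, hleft⟩ ↦ ⟨Ioc_subset_Icc_self hx, fun hc ↦ hleft ?_⟩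
    exact hc.mono (Icc_subset_Icc_right hx.2)
  · intro h
    refine measure_mono_null ?_ (measure_union_null
      ((countable_leftContinuous_not_continuous f (Icc a b)).measure_zero volume)
      (measure_union_null h (measure_singleton a)))
    rintro x ⟨hx, hc⟩
    by_cases hleft : ContinuousWithinAt f (Icc a b ∩ Iic x) x
    · exact Or.inl ⟨hx, hleft, hc⟩
    · rcases hx.1.eq_or_lt with rfl | hax
      · exact Or.inr (Or.inr rfl)
      · exact Or.inr (Or.inl ⟨⟨hax, hx.2⟩, fun h' ↦ hleft
          (h'.mono fun y hy ↦ ⟨hy.1.1, hy.2⟩)⟩)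
end

section
/- Let a < b be real numbers and f : [a,b] → ℝ a function. Then the set of discontinuity points of f is Lebesgue-negligible if and only if the set of points of (a,b] at which f does not admit a finite left-hand limit is Lebesgue-negligible. -/
open Set Filter MeasureTheory Topology

/-- The points of `(a, b]` at which `f` has a finite left-hand limit but oscillates by at
least `ε` within `[a, b]` form a countable set. -/
lemma countable_left_limit_large_oscillation (a b : ℝ) (f : ℝ → ℝ) {ε : ℝ} (hε : 0 < ε) :
    {x ∈ Ioc a b | (∃ d : ℝ, Tendsto f (𝓝[Ico a x] x) (𝓝 d)) ∧
      ¬ ∃ u ∈ 𝓝[Icc a b] x, ∀ y ∈ u, ∀ z ∈ u, dist (f y) (f z) < ε}.Countable := by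
  set E := {x ∈ Ioc a b | (∃ d : ℝ, Tendsto f (𝓝[Ico a x] x) (𝓝 d)) ∧
      ¬ ∃ u ∈ 𝓝[Icc a b] x, ∀ y ∈ u, ∀ z ∈ u, dist (f y) (f z) < ε}
  refine (countable_setOfPred_isolated_left_within (s := E)).mono ?_
  refine fun x hx ↦ ⟨hx, ?_⟩
  obtain ⟨_, ⟨d, hd⟩, _⟩ := hx
  obtain ⟨δ, hδ, hclose⟩ := Metric.mem_nhdsWithin_iff.1
    (hd.eventually (Metric.ball_mem_nhds d (half_pos hε)))
  rw [← empty_mem_iff_bot, Metric.mem_nhdsWithin_iff]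
  refine ⟨δ, hδ, ?_⟩
  rintro w ⟨hwδ, ⟨-, -, hosc⟩, hwx⟩
  refine hosc ⟨(Metric.ball x δ ∩ Iio x) ∩ Icc a b,
    inter_mem (mem_nhdsWithin_of_mem_nhds ?_) self_mem_nhdsWithin, ?_⟩
  · exact (Metric.isOpen_ball.inter isOpen_Iio).mem_nhds ⟨hwδ, hwx⟩
  · rintro y ⟨⟨hyδ, hyx⟩, hy⟩ z ⟨⟨hzδ, hzx⟩, hz⟩
    have hfy : dist (f y) d < ε / 2 := hclose ⟨hyδ, hy.1, hyx⟩
    have hfz : dist (f z) d < ε / 2 := hclose ⟨hzδ, hz.1, hzx⟩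
    linarith [dist_triangle_right (f y) (f z) d]

/-- A function has only countably many discontinuities at points of `(a, b]` where it has a
finite left-hand limit. -/
lemma countable_left_limit_not_continuous (a b : ℝ) (f : ℝ → ℝ) :
    {x ∈ Ioc a b | (∃ d : ℝ, Tendsto f (𝓝[Ico a x] x) (𝓝 d)) ∧
      ¬ ContinuousWithinAt f (Icc a b) x}.Countable := by
  refine (countable_iUnion fun n : ℕ ↦ countable_left_limit_large_oscillation a b f
    (Nat.one_div_pos_of_nat (α := ℝ) (n := n))).mono ?_
  rintro x ⟨hx, hlim, hcont⟩
  by_contra hosc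
  refine hcont (Metric.tendsto_nhds.2 fun ε hε ↦ ?_)
  obtain ⟨n, hn⟩ := exists_nat_one_div_lt hε
  obtain ⟨u, hu, hsmall⟩ :=
    not_not.1 fun hlarge ↦ hosc (mem_iUnion.2 ⟨n, hx, hlim, hlarge⟩)
  filter_upwards [hu] with y hy
  exact (hsmall y hy x (mem_of_mem_nhdsWithin (Ioc_subset_Icc_self hx) hu)).trans hn

/-- For `f : [a,b] → ℝ`, the set of discontinuity points of `f` is
Lebesgue-negligible iff the set of points of `(a,b]` at which `f` does not admit a finite
left-hand limit is Lebesgue-negligible. -/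
theorem ae_continuous_iff_ae_left_limits (a b : ℝ) (hab : a < b) (f : ℝ → ℝ) :
    volume {x ∈ Set.Icc a b | ¬ ContinuousWithinAt f (Set.Icc a b) x} = 0 ↔
    volume {x ∈ Set.Ioc a b |
      ¬ ∃ d : ℝ, Tendsto f (𝓝[Set.Ico a x] x) (𝓝 d)} = 0 := by
  constructor
  · refine fun h ↦ measure_mono_null ?_ h
    rintro x ⟨hx, hlim⟩
    exact ⟨Ioc_subset_Icc_self hx, fun hc ↦ hlim ⟨f x, hc.mono_left
      (nhdsWithin_mono x fun y hy ↦ ⟨hy.1, hy.2.le.trans hx.2⟩)⟩⟩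
  · intro h
    have hcount := ((countable_left_limit_not_continuous a b f).insert a).measure_zero volume
    refine measure_mono_null ?_ (measure_union_null hcount h)
    rintro x ⟨hx, hcont⟩
    rcases hx.1.eq_or_lt with rfl | hax
    · exact Or.inl (mem_insert _ _)
    by_cases hlim : ∃ d : ℝ, Tendsto f (𝓝[Ico a x] x) (𝓝 d)
    · exact Or.inl (Or.inr ⟨⟨hax, hx.2⟩, hlim, hcont⟩)
    · exact Or.inr ⟨⟨hax, hx.2⟩, hlim⟩
end

section
/- Let a < b be real numbers and f : [a,b] → ℝ a function. Then the set of discontinuity points of f is Lebesgue-negligible if and only if the set of points of [a,b) at which f does not admit a finite right-hand limit is Lebesgue-negligible. -/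
open Set Filter MeasureTheory Topology

/-- The points of `[a,b)` where `f` has a finite right-hand limit but oscillation at least `ε` are
isolated on the right in this set, hence countable. -/
lemma countable_oscillation_ge_of_tendsto_right (a b : ℝ) (f : ℝ → ℝ) (ε : ℝ) (hε : 0 < ε) :
    {x ∈ Set.Ico a b | (∃ d : ℝ, Tendsto f (𝓝[Set.Ioc x b] x) (𝓝 d)) ∧
      ¬ ∃ u ∈ 𝓝[Set.Icc a b] x, ∀ y ∈ u, ∀ z ∈ u, dist (f y) (f z) < ε}.Countable := by
  set S := {x ∈ Set.Ico a b | (∃ d : ℝ, Tendsto f (𝓝[Set.Ioc x b] x) (𝓝 d)) ∧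
      ¬ ∃ u ∈ 𝓝[Set.Icc a b] x, ∀ y ∈ u, ∀ z ∈ u, dist (f y) (f z) < ε}
  refine (countable_setOfPred_isolated_right_within (s := S)).mono ?_
  intro x hx
  refine ⟨hx, ?_⟩
  obtain ⟨⟨hax, hxb⟩, ⟨d, hd⟩, -⟩ := hx
  rw [nhdsWithin_Ioc_eq_nhdsGT hxb] at hd
  obtain ⟨c, hxc, hc⟩ := mem_nhdsGT_iff_exists_Ioo_subset.1
    (hd (Metric.ball_mem_nhds d (half_pos hε)))
  refine empty_mem_iff_bot.1 (mem_nhdsWithin.2 ⟨Iio c, isOpen_Iio, hxc, ?_⟩)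
  rintro y ⟨hyc, ⟨-, -, hy⟩, hxy⟩
  refine hy ⟨Ioo x c, mem_nhdsWithin_of_mem_nhds (Ioo_mem_nhds hxy hyc), fun u hu v hv => ?_⟩
  have hu' : dist (f u) d < ε / 2 := hc hu
  have hv' : dist (f v) d < ε / 2 := hc hv
  linarith [dist_triangle_right (f u) (f v) d]

/-- A real function on `[a,b]` has only countably many discontinuities at which it admits a
finite right-hand limit. -/
lemma countable_not_continuousWithinAt_of_tendsto_right (a b : ℝ) (f : ℝ → ℝ) :
    {x ∈ Set.Ico a b | (∃ d : ℝ, Tendsto f (𝓝[Set.Ioc x b] x) (𝓝 d)) ∧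
      ¬ ContinuousWithinAt f (Set.Icc a b) x}.Countable := by
  refine (countable_iUnion fun n : ℕ => countable_oscillation_ge_of_tendsto_right a b f
    (1 / ((n : ℝ) + 1)) Nat.one_div_pos_of_nat).mono ?_
  rintro x ⟨hx, hd, hc⟩
  by_contra hcon
  refine hc (Metric.tendsto_nhds.2 fun ε hε => ?_)
  obtain ⟨n, hn⟩ := exists_nat_one_div_lt hε
  have hosc : ∃ u ∈ 𝓝[Set.Icc a b] x, ∀ y ∈ u, ∀ z ∈ u, dist (f y) (f z) < 1 / ((n : ℝ) + 1) := by
    by_contra h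
    exact hcon (mem_iUnion.2 ⟨n, hx, hd, h⟩)
  obtain ⟨u, hu, huf⟩ := hosc
  filter_upwards [hu] with y hy
  exact (huf y hy x (mem_of_mem_nhdsWithin (Ico_subset_Icc_self hx) hu)).trans hn

/-- For `f : [a,b] → ℝ`, the set of discontinuity points of `f` is
Lebesgue-negligible iff the set of points of `[a,b)` at which `f` does not admit a finite
right-hand limit is Lebesgue-negligible. -/
theorem ae_continuous_iff_ae_right_limits (a b : ℝ) (hab : a < b) (f : ℝ → ℝ) :
    volume {x ∈ Set.Icc a b | ¬ ContinuousWithinAt f (Set.Icc a b) x} = 0 ↔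
    volume {x ∈ Set.Ico a b |
      ¬ ∃ d : ℝ, Tendsto f (𝓝[Set.Ioc x b] x) (𝓝 d)} = 0 := by
  constructor
  · refine measure_mono_null ?_
    rintro x ⟨hx, hd⟩
    exact ⟨Ico_subset_Icc_self hx, fun hc => hd ⟨f x, hc.mono_left
      (nhdsWithin_mono x fun y hy => ⟨hx.1.trans hy.1.le, hy.2⟩)⟩⟩
  · intro h
    refine measure_mono_null ?_ (measure_union_null (measure_union_null h
      ((countable_not_continuousWithinAt_of_tendsto_right a b f).measure_zero volume))
      ((countable_singleton b).measure_zero volume))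
    rintro x ⟨hx, hc⟩
    rcases hx.2.eq_or_lt with rfl | hxb
    · exact Or.inr rfl
    · by_cases hd : ∃ d : ℝ, Tendsto f (𝓝[Set.Ioc x b] x) (𝓝 d)
      · exact Or.inl (Or.inr ⟨⟨hx.1, hxb⟩, hd, hc⟩)
      · exact Or.inl (Or.inl ⟨⟨hx.1, hxb⟩, hd⟩)
end

section
/- Let a < b be real numbers and f : [a,b] → ℝ a function. Then the set of discontinuity points of f is at most countable if and only if the set of points of [a,b) at which f does not admit a finite right-hand limit is at most countable. -/
open Set Filter MeasureTheory Topology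

/-- Points with a right limit at which `f` oscillates by at least `ε` are isolated on the right
among themselves, hence countably many. -/
theorem countable_right_limit_of_large_oscillation (a b : ℝ) (f : ℝ → ℝ) {ε : ℝ} (hε : 0 < ε) :
    {x ∈ Ico a b | (∃ d : ℝ, Tendsto f (𝓝[Ioc x b] x) (𝓝 d)) ∧
      ¬ ∀ᶠ u in 𝓝[Icc a b] x, dist (f u) (f x) < ε}.Countable := by
  set S := {x ∈ Ico a b | (∃ d : ℝ, Tendsto f (𝓝[Ioc x b] x) (𝓝 d)) ∧
      ¬ ∀ᶠ u in 𝓝[Icc a b] x, dist (f u) (f x) < ε}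
  refine (countable_setOfPred_isolated_right_within (s := S)).mono ?_
  intro x hx
  refine ⟨hx, ?_⟩
  obtain ⟨⟨-, hxb⟩, ⟨d, hd⟩, -⟩ := hx
  rw [nhdsWithin_Ioc_eq_nhdsGT hxb] at hd
  obtain ⟨c, hc, hcd⟩ := (mem_nhdsGT_iff_exists_Ioo_subset' hxb).1
    (hd (Metric.ball_mem_nhds d (half_pos hε)))
  rw [← empty_mem_iff_bot]
  filter_upwards [nhdsWithin_mono x inter_subset_right (Ioo_mem_nhdsGT hc),
    self_mem_nhdsWithin] with y hy hyS
  refine hyS.1.2.2 ?_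
  filter_upwards [mem_nhdsWithin_of_mem_nhds (isOpen_Ioo.mem_nhds hy)] with u hu
  calc dist (f u) (f y) ≤ dist (f u) d + dist (f y) d := dist_triangle_right _ _ _
    _ < ε / 2 + ε / 2 := add_lt_add (hcd hu) (hcd hy)
    _ = ε := add_halves ε

/-- For `f : [a,b] → ℝ`, the set of discontinuity points of `f` is at most
countable iff the set of points of `[a,b)` at which `f` does not admit a finite right-hand
limit is at most countable. -/
theorem countable_discontinuities_iff_countable_right_limits (a b : ℝ) (hab : a < b)
    (f : ℝ → ℝ) :
    {x ∈ Set.Icc a b | ¬ ContinuousWithinAt f (Set.Icc a b) x}.Countable ↔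
    {x ∈ Set.Ico a b |
      ¬ ∃ d : ℝ, Tendsto f (𝓝[Set.Ioc x b] x) (𝓝 d)}.Countable := by
  constructor
  · intro h
    refine h.mono ?_
    intro x hx
    refine ⟨Ico_subset_Icc_self hx.1, fun hc ↦ hx.2 ⟨f x, ?_⟩⟩
    exact hc.mono_left (nhdsWithin_mono x fun y hy ↦ ⟨hx.1.1.trans hy.1.le, hy.2⟩)
  · intro h
    refine ((h.union (countable_singleton b)).union (countable_iUnion fun n : ℕ ↦
      countable_right_limit_of_large_oscillation a b f
        (Nat.one_div_pos_of_nat (α := ℝ) (n := n)))).mono ?_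
    rintro x ⟨hx, hc⟩
    rcases hx.2.eq_or_lt with rfl | hxb
    · exact Or.inl (Or.inr rfl)
    by_cases hd : ∃ d : ℝ, Tendsto f (𝓝[Ioc x b] x) (𝓝 d)
    · refine Or.inr (mem_iUnion.2 ?_)
      by_contra hn
      refine hc (Metric.tendsto_nhds.2 fun ε hε ↦ ?_)
      obtain ⟨n, hnε⟩ := exists_nat_one_div_lt hε
      have hev : ∀ᶠ u in 𝓝[Icc a b] x, dist (f u) (f x) < 1 / ((n : ℝ) + 1) := by
        by_contra hev
        exact hn ⟨n, ⟨hx.1, hxb⟩, hd, hev⟩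
      exact hev.mono fun u hu ↦ hu.trans hnε
    · exact Or.inl (Or.inl ⟨⟨hx.1, hxb⟩, hd⟩)
end

section
/- Let a < b be real numbers and f : [a,b] → ℝ a function. Then the set of discontinuity points of f is at most countable if and only if the set of points of (a,b] at which f is not left-hand continuous is at most countable. -/
open Set Filter MeasureTheory Topology

/-- Along any set `s`, a function is continuous at all but countably many of the points at which
it is left-continuous. -/
theorem countable_setOfPred_not_continuousWithinAt_of_left {α β : Type*} [LinearOrder α]
    [TopologicalSpace α] [OrderTopology α] [SecondCountableTopology α]
    [PseudoMetricSpace β] (s : Set α) (f : α → β) :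
    {x ∈ s | ContinuousWithinAt f (s ∩ Iic x) x ∧ ¬ ContinuousWithinAt f s x}.Countable := by
  let D : ℕ → Set α := fun n ↦
    {x ∈ s | ∀ u ∈ 𝓝[s] x, ∃ y ∈ u, ∃ z ∈ u, 1 / ((n : ℝ) + 1) ≤ dist (f y) (f z)}
  refine (countable_iUnion fun n ↦ countable_setOfPred_isolated_left_within (s := D n)).mono ?_
  rintro x ⟨hxs, hleft, hx⟩
  obtain ⟨n, hn⟩ : ∃ n, x ∈ D n := by
    by_contra! h
    refine hx (Metric.tendsto_nhds.2 fun ε hε ↦ ?_)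
    obtain ⟨n, hn⟩ := exists_nat_one_div_lt hε
    have hxn := h n
    simp only [D, mem_ofPred_eq, not_and, not_forall, not_exists, not_le] at hxn
    obtain ⟨u, hu, hosc⟩ := hxn hxs
    filter_upwards [hu] with y hy
    exact (hosc y hy x (mem_of_mem_nhdsWithin hxs hu)).trans hn
  have hpos : (0 : ℝ) < 1 / ((n : ℝ) + 1) / 2 := by positivity
  have hnhds := Metric.tendsto_nhds.1 hleft _ hpos
  obtain ⟨v, hv, hxv, hvs⟩ := mem_nhdsWithin.1 hnhds
  refine mem_iUnion.2 ⟨n, hn, ?_⟩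
  rw [← empty_mem_iff_bot, mem_nhdsWithin]
  refine ⟨v, hv, hxv, ?_⟩
  rintro z ⟨hzv, ⟨hzs, hz⟩, hzx⟩
  obtain ⟨y, hy, w, hw, hyw⟩ :=
    hz _ (inter_mem_nhdsWithin s ((hv.inter isOpen_Iio).mem_nhds ⟨hzv, hzx⟩))
  have key : ∀ y ∈ s ∩ (v ∩ Iio x), dist (f y) (f x) < 1 / ((n : ℝ) + 1) / 2 := fun y hy ↦
    hvs ⟨hy.2.1, hy.1, le_of_lt hy.2.2⟩
  exfalso
  linarith [key y hy, key w hw, dist_triangle_right (f y) (f w) (f x)]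

/-- For `f : [a,b] → ℝ`, the set of discontinuity points of `f` is at most
countable iff the set of points of `(a,b]` at which `f` is not left-hand continuous is at
most countable. -/
theorem countable_discontinuities_iff_countable_left_discont (a b : ℝ) (hab : a < b)
    (f : ℝ → ℝ) :
    {x ∈ Set.Icc a b | ¬ ContinuousWithinAt f (Set.Icc a b) x}.Countable ↔
    {x ∈ Set.Ioc a b | ¬ ContinuousWithinAt f (Set.Icc a x) x}.Countable := by
  constructor
  · refine fun h ↦ h.mono ?_
    rintro x ⟨hx, hleft⟩
    exact ⟨Ioc_subset_Icc_self hx, fun hc ↦ hleft (hc.mono (Icc_subset_Icc_right hx.2))⟩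
  · intro h
    refine ((h.union (countable_setOfPred_not_continuousWithinAt_of_left (Icc a b) f)).union
      (countable_singleton a)).mono ?_
    rintro x ⟨hx, hdisc⟩
    rcases hx.1.eq_or_lt with rfl | hax
    · exact Or.inr rfl
    by_cases hleft : ContinuousWithinAt f (Icc a x) x
    · exact Or.inl (Or.inr ⟨hx, hleft.mono fun y hy ↦ ⟨hy.1.1, hy.2⟩, hdisc⟩)
    · exact Or.inl (Or.inl ⟨⟨hax, hx.2⟩, hleft⟩)
end

section
/- Let a < b be real numbers and f : [a,b] → ℝ a function. Then the set of discontinuity points of f is Lebesgue-negligible if and only if the set of points of [a,b) at which f is not right-hand continuous is Lebesgue-negligible. -/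
open Set Filter MeasureTheory Topology

/-- A function on a second-countable linear order with values in a metric space has only countably
many points at which it is right-continuous but not continuous. -/
theorem countable_right_continuous_not_continuousAt {α E : Type*} [LinearOrder α]
    [TopologicalSpace α] [OrderTopology α] [SecondCountableTopology α] [PseudoMetricSpace E]
    (f : α → E) :
    {x | ContinuousWithinAt f (Ici x) x ∧ ¬ ContinuousAt f x}.Countable := by
  let A : ℕ → Set α := fun n ↦ {x | ContinuousWithinAt f (Ici x) x ∧
    ∀ U ∈ 𝓝 x, ∃ y ∈ U, ∃ z ∈ U, 1 / ((n : ℝ) + 1) ≤ dist (f y) (f z)}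
  have hA (n : ℕ) : (A n).Countable := by
    refine (countable_setOfPred_isolated_right_within (s := A n)).mono ?_
    intro x hx
    refine ⟨hx, ?_⟩
    have hpos : 0 < 1 / ((n : ℝ) + 1) / 2 := by positivity
    have hnear : ∀ᶠ y in 𝓝[≥] x, dist (f y) (f x) < 1 / ((n : ℝ) + 1) / 2 :=
      Metric.tendsto_nhds.1 hx.1 _ hpos
    by_cases hmax : ∃ u, x < u
    · obtain ⟨u, hu, hsub⟩ := (mem_nhdsGE_iff_exists_Ico_subset' hmax.choose_spec).1 hnear
      rw [← empty_mem_iff_bot]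
      refine mem_of_superset (inter_mem self_mem_nhdsWithin
        (mem_nhdsWithin_of_mem_nhds (Iio_mem_nhds hu))) ?_
      rintro t ⟨⟨ht, hxt⟩, htu⟩
      obtain ⟨y, hy, z, hz, hyz⟩ := ht.2 (Ioo x u) (Ioo_mem_nhds hxt htu)
      have hy' : dist (f y) (f x) < _ := hsub (Ioo_subset_Ico_self hy)
      have hz' : dist (f z) (f x) < _ := hsub (Ioo_subset_Ico_self hz)
      linarith [dist_triangle_right (f y) (f z) (f x)]
    · have hempty : Ioi x = ∅ := eq_empty_of_forall_notMem fun u hu ↦ hmax ⟨u, hu⟩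
      simp [hempty]
  refine (countable_iUnion hA).mono ?_
  rintro x ⟨hright, hx⟩
  rw [ContinuousAt, Metric.tendsto_nhds] at hx
  push Not at hx
  obtain ⟨ε, hε, hfreq⟩ := hx
  obtain ⟨n, hn⟩ := exists_nat_one_div_lt hε
  refine mem_iUnion.2 ⟨n, hright, fun U hU ↦ ?_⟩
  obtain ⟨y, hy, hyU⟩ := (hfreq.and_eventually hU).exists
  exact ⟨y, hyU, x, mem_of_mem_nhds hU, hn.le.trans hy⟩

/-- For `f : [a,b] → ℝ`, the set of discontinuity points of `f` is
Lebesgue-negligible iff the set of points of `[a,b)` at which `f` is not right-hand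
continuous is Lebesgue-negligible. -/
theorem ae_continuous_iff_ae_right_continuous (a b : ℝ) (hab : a < b) (f : ℝ → ℝ) :
    volume {x ∈ Set.Icc a b | ¬ ContinuousWithinAt f (Set.Icc a b) x} = 0 ↔
    volume {x ∈ Set.Ico a b | ¬ ContinuousWithinAt f (Set.Icc x b) x} = 0 := by
  constructor
  · refine measure_mono_null fun x hx ↦ ⟨Ico_subset_Icc_self hx.1, fun hc ↦ hx.2 ?_⟩
    exact hc.mono (Icc_subset_Icc_left hx.1.1)
  · intro h
    have hcount : volume ({x | ContinuousWithinAt f (Ici x) x ∧ ¬ ContinuousAt f x} ∪ {a, b}) = 0 :=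
      ((countable_right_continuous_not_continuousAt f).union
        (toFinite {a, b}).countable).measure_zero _
    refine measure_mono_null ?_ (measure_union_null h hcount)
    rintro x ⟨hx, hdisc⟩
    rcases hx.1.eq_or_lt with rfl | hax
    · simp
    rcases hx.2.eq_or_lt with rfl | hxb
    · simp
    by_cases hright : ContinuousWithinAt f (Icc x b) x
    · refine Or.inr (Or.inl ⟨?_, fun hc ↦ hdisc hc.continuousWithinAt⟩)
      exact (continuousWithinAt_Icc_iff_Ici hxb).1 hright
    · exact Or.inl ⟨⟨hx.1, hxb⟩, hright⟩
end

section
/- Let a < b be real numbers and let f : [a,b] → ℝ be a bounded function. Then f is Riemann integrable on [a,b] if and only if the set of points of (a,b] at which f does not admit a finite left-hand limit is Lebesgue-negligible. -/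
open Set Filter MeasureTheory Topology

/-- Classical Riemann integrability of `f` on `[a,b]`: there is `I : ℝ` such that for every
`ε > 0` there is `δ > 0` such that every Riemann sum of `f` over a tagged partition
`a = x 0 < x 1 < ⋯ < x n = b` of `[a,b]` of mesh `< δ`, with tags `t i ∈ [x i, x (i+1)]`,
is within `ε` of `I`. -/
def RiemannIntegrableOn (f : ℝ → ℝ) (a b : ℝ) : Prop :=
  ∃ I : ℝ, ∀ ε : ℝ, 0 < ε → ∃ δ : ℝ, 0 < δ ∧
    ∀ (n : ℕ) (x t : ℕ → ℝ),
      0 < n → x 0 = a → x n = b →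
      (∀ i < n, x i < x (i + 1)) →
      (∀ i < n, x (i + 1) - x i < δ) →
      (∀ i < n, t i ∈ Set.Icc (x i) (x (i + 1))) →
      |(∑ i ∈ Finset.range n, f (t i) * (x (i + 1) - x i)) - I| < ε

theorem partition_le {n : ℕ} {x : ℕ → ℝ} (hx : ∀ i < n, x i < x (i + 1)) {i j : ℕ}
    (hij : i ≤ j) (hj : j ≤ n) : x i ≤ x j := by
  induction j, hij using Nat.le_induction with
  | base => exact le_rfl
  | succ k _ ih => exact (ih (by omega)).trans (hx k (by omega)).le

theorem exists_mem_Ioc_of_partition (n : ℕ) (x : ℕ → ℝ) {y : ℝ} (hy : y ∈ Ioc (x 0) (x n)) :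
    ∃ i < n, y ∈ Ioc (x i) (x (i + 1)) := by
  induction n with
  | zero => exact absurd (hy.1.trans_le hy.2) (lt_irrefl _)
  | succ k ih =>
    by_cases h : y ≤ x k
    · obtain ⟨i, hi, hyi⟩ := ih ⟨hy.1, h⟩
      exact ⟨i, by omega, hyi⟩
    · exact ⟨k, by omega, not_le.mp h, hy.2⟩

theorem exists_partition_mesh_lt {a b δ : ℝ} (hab : a < b) (hδ : 0 < δ) :
    ∃ (n : ℕ) (x : ℕ → ℝ), 0 < n ∧ x 0 = a ∧ x n = b ∧
      (∀ i < n, x i < x (i + 1)) ∧ ∀ i < n, x (i + 1) - x i < δ := by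
  obtain ⟨n, hn⟩ := exists_nat_gt ((b - a) / δ)
  have hn0 : (0 : ℝ) < n := (div_pos (sub_pos.mpr hab) hδ).trans hn
  have hstep : 0 < (b - a) / n := div_pos (sub_pos.mpr hab) hn0
  refine ⟨n, fun i => a + i * ((b - a) / n), by exact_mod_cast hn0, by simp, ?_, ?_, ?_⟩
  · field_simp
    ring
  · intro i _
    push_cast
    linarith
  · intro i _
    have : (b - a) / n < δ := by
      rw [div_lt_iff₀ hδ] at hn
      rw [div_lt_iff₀ hn0]
      linarith
    push_cast
    linarith

theorem RiemannIntegrableOn.volume_leftOscillation_eq_zero {f : ℝ → ℝ} {a b : ℝ} (hab : a < b)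
    (hf : RiemannIntegrableOn f a b) {ε : ℝ} (hε : 0 < ε) :
    volume {y ∈ Ioc a b | ∀ c, a ≤ c → c < y → ∃ u ∈ Ico c y, ∃ v ∈ Ico c y, ε ≤ f u - f v} = 0 := by
  classical
  obtain ⟨I, hI⟩ := hf
  refine le_antisymm (ENNReal.le_of_forall_pos_le_add fun η hη _ => ?_) zero_le
  have hη : (0 : ℝ) < η := hη
  obtain ⟨δ, hδ, hsum⟩ := hI (ε * η / 2) (by positivity)
  obtain ⟨n, x, hn, h0, hxn, hx, hmesh⟩ := exists_partition_mesh_lt hab hδ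
  let P : ℕ → Prop := fun i =>
    ∃ u ∈ Icc (x i) (x (i + 1)), ∃ v ∈ Icc (x i) (x (i + 1)), ε ≤ f u - f v
  have htags : ∀ i, ∃ u v, i < n → u ∈ Icc (x i) (x (i + 1)) ∧ v ∈ Icc (x i) (x (i + 1)) ∧
      (if P i then ε else 0) ≤ f u - f v := by
    intro i
    by_cases hP : P i
    · obtain ⟨u, hu, v, hv, h⟩ := hP
      exact ⟨u, v, fun _ => ⟨hu, hv, by split_ifs <;> linarith⟩⟩
    · exact ⟨x i, x i, fun hi =>
        ⟨left_mem_Icc.mpr (hx i hi).le, left_mem_Icc.mpr (hx i hi).le, by simp [hP]⟩⟩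
  choose u v huv using htags
  have hu := abs_lt.mp (hsum n x u hn h0 hxn hx hmesh fun i hi => (huv i hi).1)
  have hv := abs_lt.mp (hsum n x v hn h0 hxn hx hmesh fun i hi => (huv i hi).2.1)
  have hle : ε * ∑ i ∈ Finset.range n with P i, (x (i + 1) - x i) ≤
      (∑ i ∈ Finset.range n, f (u i) * (x (i + 1) - x i)) -
        ∑ i ∈ Finset.range n, f (v i) * (x (i + 1) - x i) := by
    rw [Finset.sum_filter, Finset.mul_sum, ← Finset.sum_sub_distrib]
    refine Finset.sum_le_sum fun i hi => ?_
    have hi := Finset.mem_range.mp hi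
    have := mul_le_mul_of_nonneg_right (huv i hi).2.2 (sub_pos.mpr (hx i hi)).le
    split_ifs at this ⊢ <;> linarith
  have hlt : ∑ i ∈ Finset.range n with P i, (x (i + 1) - x i) ≤ η := by
    refine le_of_mul_le_mul_left ?_ hε
    linarith [hu.2, hv.1]
  rw [zero_add]
  calc _ ≤ volume (⋃ i ∈ (Finset.range n).filter P, Ioc (x i) (x (i + 1))) := by
        refine measure_mono ?_
        rintro y ⟨hy, hosc⟩
        obtain ⟨i, hi, hyi⟩ := exists_mem_Ioc_of_partition n x (by rwa [h0, hxn])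
        have hai : a ≤ x i := h0 ▸ partition_le hx (Nat.zero_le i) hi.le
        obtain ⟨u, hu, v, hv, h⟩ := hosc (x i) hai hyi.1
        refine mem_biUnion (Finset.mem_filter.mpr ⟨Finset.mem_range.mpr hi, ?_⟩) hyi
        exact ⟨u, ⟨hu.1, hu.2.le.trans hyi.2⟩, v, ⟨hv.1, hv.2.le.trans hyi.2⟩, h⟩
    _ ≤ ∑ i ∈ (Finset.range n).filter P, volume (Ioc (x i) (x (i + 1))) :=
        measure_biUnion_finset_le _ _
    _ = ENNReal.ofReal (∑ i ∈ (Finset.range n).filter P, (x (i + 1) - x i)) := by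
        simp_rw [Real.volume_Ioc]
        refine (ENNReal.ofReal_sum_of_nonneg fun i hi => ?_).symm
        exact (sub_pos.mpr (hx i (Finset.mem_range.mp (Finset.mem_filter.mp hi).1))).le
    _ ≤ η := by
        rw [← ENNReal.ofReal_coe_nnreal]
        exact ENNReal.ofReal_le_ofReal hlt

theorem exists_tendsto_left_of_forall_oscillation_lt {f : ℝ → ℝ} {a y : ℝ} (hay : a < y)
    (h : ∀ k : ℕ, ∃ c, a ≤ c ∧ c < y ∧
      ∀ u ∈ Ico c y, ∀ v ∈ Ico c y, f u - f v < 1 / ((k : ℝ) + 1)) :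
    ∃ d, Tendsto f (𝓝[Ico a y] y) (𝓝 d) := by
  have hne : (𝓝[Ico a y] y).NeBot := by
    rw [← mem_closure_iff_nhdsWithin_neBot, closure_Ico hay.ne]
    exact right_mem_Icc.mpr hay.le
  rw [← cauchy_map_iff_exists_tendsto, Metric.cauchy_iff]
  refine ⟨hne.map f, fun ε hε => ?_⟩
  obtain ⟨k, hk⟩ := exists_nat_one_div_lt hε
  obtain ⟨c, hac, hcy, hc⟩ := h k
  refine ⟨f '' Ico c y, image_mem_map ?_, ?_⟩
  · exact nhdsWithin_mono y Ico_subset_Iio_self (Ico_mem_nhdsLT hcy)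
  · rintro _ ⟨u, hu, rfl⟩ _ ⟨v, hv, rfl⟩
    rw [Real.dist_eq, abs_lt]
    constructor <;> linarith [hc u hu v hv, hc v hv u hu]

theorem countable_leftLimit_not_continuousAt (f : ℝ → ℝ) (a : ℝ) :
    {y ∈ Ioi a | (∃ d, Tendsto f (𝓝[Ico a y] y) (𝓝 d)) ∧ ¬ ContinuousAt f y}.Countable := by
  let B : ℕ → Set ℝ := fun k => {y ∈ Ioi a | (∃ d, Tendsto f (𝓝[Ico a y] y) (𝓝 d)) ∧
    ∀ U ∈ 𝓝 y, ∃ u ∈ U, ∃ v ∈ U, 1 / ((k : ℝ) + 1) ≤ |f u - f v|}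
  have hB : ∀ k, (B k).Countable := by
    intro k
    refine (countable_setOfPred_isolated_left_within (s := B k)).mono ?_
    intro y hy
    refine ⟨hy, ?_⟩
    obtain ⟨hay, ⟨d, hd⟩, _⟩ := hy
    have hk : (0 : ℝ) < 1 / ((k : ℝ) + 1) := by positivity
    have hmem : {z | |f z - d| < 1 / ((k : ℝ) + 1) / 2} ∈ 𝓝[<] y := by
      rw [← nhdsWithin_Ico_eq_nhdsLT hay]
      exact hd (Metric.ball_mem_nhds d (half_pos hk))
    obtain ⟨c, hcy, hc⟩ := mem_nhdsLT_iff_exists_Ioo_subset.mp hmem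
    rw [← empty_mem_iff_bot, mem_nhdsWithin]
    refine ⟨Ioi c, isOpen_Ioi, hcy, ?_⟩
    rintro z ⟨hcz, hz, hzy⟩
    obtain ⟨u, hu, v, hv, huv⟩ := hz.2.2 _ (Ioo_mem_nhds hcz hzy)
    have h1 : |f u - d| < _ := hc hu
    have h2 : |f v - d| < _ := hc hv
    have := abs_sub_le (f u) d (f v)
    rw [abs_sub_comm d] at this
    linarith
  refine (countable_iUnion hB).mono ?_
  rintro y ⟨hay, hd, hcont⟩
  by_contra hy
  refine hcont (Metric.continuousAt_iff'.mpr fun ε hε => ?_)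
  obtain ⟨k, hk⟩ := exists_nat_one_div_lt hε
  have : y ∉ B k := fun h => hy (mem_iUnion.mpr ⟨k, h⟩)
  have : ∃ U ∈ 𝓝 y, ∀ u ∈ U, ∀ v ∈ U, |f u - f v| < 1 / ((k : ℝ) + 1) := by
    by_contra! h
    exact this ⟨hay, hd, h⟩
  obtain ⟨U, hU, h⟩ := this
  filter_upwards [hU] with z hz
  exact (h z hz y (mem_of_mem_nhds hU)).trans hk

/-- The step function attached to a tagged partition. -/
noncomputable def riemannStep (f : ℝ → ℝ) (n : ℕ) (x t : ℕ → ℝ) (y : ℝ) : ℝ :=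
  ∑ i ∈ Finset.range n, (Ioc (x i) (x (i + 1))).indicator (fun _ => f (t i)) y

theorem measurable_riemannStep (f : ℝ → ℝ) (n : ℕ) (x t : ℕ → ℝ) :
    Measurable (riemannStep f n x t) :=
  Finset.measurable_fun_sum _ fun _ _ => measurable_const.indicator measurableSet_Ioc

theorem riemannStep_eq {f : ℝ → ℝ} {n : ℕ} {x t : ℕ → ℝ} (hx : ∀ i < n, x i < x (i + 1))
    {i : ℕ} (hi : i < n) {y : ℝ} (hy : y ∈ Ioc (x i) (x (i + 1))) :
    riemannStep f n x t y = f (t i) := by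
  rw [riemannStep, Finset.sum_eq_single_of_mem i (Finset.mem_range.mpr hi),
    indicator_of_mem hy]
  intro j hj hji
  refine indicator_of_notMem (fun hyj => ?_) _
  rcases lt_or_gt_of_ne hji with h | h
  · linarith [hyj.2, hy.1, partition_le hx (show j + 1 ≤ i from h) hi.le]
  · linarith [hyj.1, hy.2,
      partition_le hx (show i + 1 ≤ j from h) (Finset.mem_range.mp hj).le]

theorem setIntegral_riemannStep {f : ℝ → ℝ} {n : ℕ} {x t : ℕ → ℝ}
    (hx : ∀ i < n, x i < x (i + 1)) :
    ∫ y in Ioc (x 0) (x n), riemannStep f n x t y =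
      ∑ i ∈ Finset.range n, f (t i) * (x (i + 1) - x i) := by
  unfold riemannStep
  rw [integral_finsetSum]
  · refine Finset.sum_congr rfl fun i hi => ?_
    have hi := Finset.mem_range.mp hi
    have hsub : Ioc (x i) (x (i + 1)) ⊆ Ioc (x 0) (x n) :=
      Ioc_subset_Ioc (partition_le hx (Nat.zero_le i) hi.le) (partition_le hx hi le_rfl)
    rw [setIntegral_indicator measurableSet_Ioc, inter_eq_right.mpr hsub, setIntegral_const,
      Real.volume_real_Ioc_of_le (hx i hi).le, smul_eq_mul, mul_comm]
  · intro i _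
    exact (integrable_const _).indicator measurableSet_Ioc

/-- The sufficiency half of Lebesgue's criterion for Riemann integrability. -/
theorem riemannIntegrableOn_of_ae_continuousAt {f : ℝ → ℝ} {a b : ℝ}
    (hbd : ∃ C : ℝ, ∀ x ∈ Icc a b, |f x| ≤ C)
    (hf : ∀ᵐ y ∂volume.restrict (Ioc a b), ContinuousAt f y) : RiemannIntegrableOn f a b := by
  obtain ⟨C, hC⟩ := hbd
  refine ⟨∫ y in Ioc a b, f y, fun ε hε => ?_⟩
  by_contra! hcon
  choose n x t hn h0 hxn hx hmesh ht hfar using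
    fun k : ℕ => hcon (1 / ((k : ℝ) + 1)) Nat.one_div_pos_of_nat
  have hstep : ∀ k : ℕ, ∀ y ∈ Ioc a b, ∃ s ∈ Icc a b, |s - y| ≤ 1 / ((k : ℝ) + 1) ∧
      riemannStep f (n k) (x k) (t k) y = f s := by
    intro k y hy
    obtain ⟨i, hi, hyi⟩ := exists_mem_Ioc_of_partition (n k) (x k) (by rwa [h0, hxn])
    have hti := ht k i hi
    have hxi := partition_le (hx k) (Nat.zero_le i) hi.le
    have hxi' := partition_le (hx k) (show i + 1 ≤ n k from hi) le_rfl
    rw [h0] at hxi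
    rw [hxn] at hxi'
    refine ⟨t k i, ⟨hxi.trans hti.1, hti.2.trans hxi'⟩, ?_, riemannStep_eq (hx k) hi hyi⟩
    rw [abs_le]
    constructor <;> linarith [hmesh k i hi, hti.1, hti.2, hyi.1, hyi.2]
  have hlim : Tendsto (fun k => ∫ y in Ioc a b, riemannStep f (n k) (x k) (t k) y) atTop
      (𝓝 (∫ y in Ioc a b, f y)) := by
    refine tendsto_integral_of_dominated_convergence (fun _ => C)
      (fun k => (measurable_riemannStep _ _ _ _).aestronglyMeasurable) (integrable_const C) ?_ ?_
    · intro k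
      filter_upwards [ae_restrict_mem measurableSet_Ioc] with y hy
      obtain ⟨s, hs, -, heq⟩ := hstep k y hy
      rw [heq]
      exact hC s hs
    · filter_upwards [ae_restrict_mem measurableSet_Ioc, hf] with y hy hcont
      choose s _ hsy heq using fun k => hstep k y hy
      simp_rw [heq]
      refine hcont.tendsto.comp (tendsto_iff_dist_tendsto_zero.mpr ?_)
      exact squeeze_zero (fun _ => dist_nonneg) hsy tendsto_one_div_add_atTop_nhds_zero_nat
  obtain ⟨k, hk⟩ := (Metric.tendsto_nhds.mp hlim ε hε).exists
  have hint := setIntegral_riemannStep (f := f) (t := t k) (hx k)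
  rw [h0, hxn] at hint
  rw [Real.dist_eq, hint] at hk
  exact (hfar k).not_gt hk

/-- A bounded function `f : [a,b] → ℝ` is Riemann integrable on `[a,b]` iff
the set of points of `(a,b]` at which `f` does not admit a finite left-hand limit is
Lebesgue-negligible. -/
theorem riemannIntegrable_iff_ae_left_limits (a b : ℝ) (hab : a < b) (f : ℝ → ℝ)
    (hbd : ∃ C : ℝ, ∀ x ∈ Set.Icc a b, |f x| ≤ C) :
    RiemannIntegrableOn f a b ↔
    volume {x ∈ Set.Ioc a b |
      ¬ ∃ d : ℝ, Tendsto f (𝓝[Set.Ico a x] x) (𝓝 d)} = 0 := by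
  constructor
  · intro hf
    refine measure_mono_null ?_ (measure_iUnion_null fun k : ℕ =>
      hf.volume_leftOscillation_eq_zero hab (Nat.one_div_pos_of_nat (α := ℝ) (n := k)))
    rintro y ⟨hy, hlim⟩
    by_contra hnot
    refine hlim (exists_tendsto_left_of_forall_oscillation_lt hy.1 fun k => ?_)
    by_contra! hk
    exact hnot (mem_iUnion.mpr ⟨k, hy, hk⟩)
  · intro h
    refine riemannIntegrableOn_of_ae_continuousAt hbd ?_
    rw [ae_restrict_iff' measurableSet_Ioc]
    filter_upwards [measure_eq_zero_iff_ae_notMem.mp h,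
      (countable_leftLimit_not_continuousAt f a).ae_notMem volume] with y hlim hcont hy
    by_contra hnc
    exact hcont ⟨hy.1, by_contra fun hd => hlim ⟨hy, hd⟩, hnc⟩
end

section
/- Let a < b be real numbers and let f : [a,b] → ℝ be a bounded function. Then f is Riemann integrable on [a,b] if and only if the set of points of [a,b) at which f does not admit a finite right-hand limit is Lebesgue-negligible. -/
open Set Filter MeasureTheory Topology

/-- Weak monotonicity of the division points of a tagged partition. -/
lemma partition_le_of_le {x : ℕ → ℝ} {n : ℕ} (hx : ∀ i < n, x i < x (i + 1)) {i j : ℕ}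
    (hij : i ≤ j) (hj : j ≤ n) : x i ≤ x j := by
  induction j, hij using Nat.le_induction with
  | base => exact le_rfl
  | succ j _ ih => exact (ih (by omega)).trans (hx j (by omega)).le

lemma exists_mem_Ico_partition {x : ℕ → ℝ} {n : ℕ} {u : ℝ} (h0 : x 0 ≤ u) (hn : u < x n) :
    ∃ i < n, u ∈ Ico (x i) (x (i + 1)) := by
  induction n with
  | zero => exact absurd hn h0.not_gt
  | succ n ih =>
    rcases lt_or_ge u (x n) with h | h
    · obtain ⟨i, hi, hu⟩ := ih h
      exact ⟨i, by omega, hu⟩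
    · exact ⟨n, by omega, h, hn⟩

/-- The step function taking the value `c i` on `[x i, x (i + 1))` for `i < n`. -/
noncomputable def partitionStep (c x : ℕ → ℝ) (n : ℕ) (u : ℝ) : ℝ :=
  ∑ i ∈ Finset.range n, (Ico (x i) (x (i + 1))).indicator (fun _ => c i) u

lemma partitionStep_eq {c x : ℕ → ℝ} {n i : ℕ} {u : ℝ} (hx : ∀ i < n, x i < x (i + 1))
    (hi : i < n) (hu : u ∈ Ico (x i) (x (i + 1))) : partitionStep c x n u = c i := by
  rw [partitionStep, Finset.sum_eq_single_of_mem i (Finset.mem_range.2 hi), indicator_of_mem hu]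
  intro j hj hji
  rw [Finset.mem_range] at hj
  refine indicator_of_notMem (fun hu' => ?_) _
  rcases lt_or_gt_of_ne hji with h | h
  · have := partition_le_of_le hx (i := j + 1) (j := i) h hi.le
    linarith [hu.1, hu'.2]
  · have := partition_le_of_le hx (i := i + 1) (j := j) h hj.le
    linarith [hu'.1, hu.2]

lemma measurable_partitionStep (c x : ℕ → ℝ) (n : ℕ) : Measurable (partitionStep c x n) :=
  Finset.measurable_fun_sum _ fun _ _ => measurable_const.indicator measurableSet_Ico

lemma setIntegral_partitionStep (c : ℕ → ℝ) {x : ℕ → ℝ} {n : ℕ}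
    (hx : ∀ i < n, x i < x (i + 1)) :
    ∫ u in Ico (x 0) (x n), partitionStep c x n u =
      ∑ i ∈ Finset.range n, c i * (x (i + 1) - x i) := by
  unfold partitionStep
  rw [integral_finsetSum]
  · refine Finset.sum_congr rfl fun i hi => ?_
    rw [Finset.mem_range] at hi
    have hsub : Ico (x i) (x (i + 1)) ⊆ Ico (x 0) (x n) :=
      Ico_subset_Ico (partition_le_of_le hx zero_le hi.le) (partition_le_of_le hx hi le_rfl)
    rw [integral_indicator_const _ measurableSet_Ico,
      measureReal_restrict_apply measurableSet_Ico, inter_eq_left.2 hsub,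
      Real.volume_real_Ico_of_le (hx i hi).le, smul_eq_mul, mul_comm]
  · exact fun i _ => (integrable_const _).indicator measurableSet_Ico

/-- A bounded function that is a.e. continuous within `[a, b]` is Riemann integrable. -/
lemma RiemannIntegrableOn.of_ae_continuousWithinAt {a b : ℝ} {f : ℝ → ℝ} {C : ℝ}
    (hC : ∀ x ∈ Icc a b, |f x| ≤ C)
    (hf : ∀ᵐ x ∂volume.restrict (Ico a b), ContinuousWithinAt f (Icc a b) x) :
    RiemannIntegrableOn f a b := by
  refine ⟨∫ u in Ico a b, f u, fun ε hε => ?_⟩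
  by_contra! H
  choose n x t _ h0 hn hx hmesh ht hfar using fun k : ℕ =>
    H (1 / ((k : ℝ) + 1)) Nat.one_div_pos_of_nat
  have hloc : ∀ k, ∀ u ∈ Ico a b, ∃ i, t k i ∈ Icc a b ∧ |t k i - u| ≤ 1 / ((k : ℝ) + 1) ∧
      partitionStep (fun i => f (t k i)) (x k) (n k) u = f (t k i) := by
    intro k u hu
    obtain ⟨i, hi, hui⟩ := exists_mem_Ico_partition (x := x k) (n := n k)
      ((h0 k).le.trans hu.1) (hu.2.trans_le (hn k).ge)
    have h1 := partition_le_of_le (hx k) zero_le hi.le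
    have h2 := partition_le_of_le (hx k) (i := i + 1) hi le_rfl
    rw [h0 k] at h1
    rw [hn k] at h2
    have h3 := ht k i hi
    have h4 := hmesh k i hi
    refine ⟨i, ⟨h1.trans h3.1, h3.2.trans h2⟩, ?_, partitionStep_eq (hx k) hi hui⟩
    rw [abs_le]
    constructor <;> linarith [h3.1, h3.2, hui.1, hui.2]
  have key : Tendsto (fun k => ∫ u in Ico a b, partitionStep (fun i => f (t k i)) (x k) (n k) u)
      atTop (𝓝 (∫ u in Ico a b, f u)) := by
    refine tendsto_integral_of_dominated_convergence (fun _ => C)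
      (fun k => (measurable_partitionStep _ _ _).aestronglyMeasurable) (integrable_const _)
      (fun k => ?_) ?_
    · refine (ae_restrict_iff' measurableSet_Ico).2 (Eventually.of_forall fun u hu => ?_)
      obtain ⟨i, hi, -, h⟩ := hloc k u hu
      rw [h]
      exact hC _ hi
    · filter_upwards [hf, ae_restrict_mem measurableSet_Ico] with u hcont hu
      choose i hi hdist heq using fun k => hloc k u hu
      simp only [heq]
      refine hcont.tendsto.comp (tendsto_nhdsWithin_iff.2 ⟨?_, Eventually.of_forall hi⟩)
      rw [tendsto_iff_dist_tendsto_zero]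
      exact squeeze_zero (fun _ => dist_nonneg) hdist tendsto_one_div_add_atTop_nhds_zero_nat
  obtain ⟨k, hk⟩ := ((Metric.tendsto_nhds.1 key) ε hε).exists
  have hint := setIntegral_partitionStep (fun i => f (t k i)) (hx k)
  rw [h0 k, hn k] at hint
  rw [hint, Real.dist_eq] at hk
  exact (hfar k).not_gt hk

/-- A function has at most countably many points of `[a, b)` at which it has a right-hand limit
but is not continuous. -/
lemma countable_rightLimit_not_continuousWithinAt (a b : ℝ) (f : ℝ → ℝ) :
    {x ∈ Ico a b | (∃ d, Tendsto f (𝓝[Ioc x b] x) (𝓝 d)) ∧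
      ¬ ContinuousWithinAt f (Icc a b) x}.Countable := by
  let E : ℕ → Set ℝ := fun k => {x ∈ Ico a b | (∃ d, Tendsto f (𝓝[Ioc x b] x) (𝓝 d)) ∧
    ∃ᶠ u in 𝓝[Icc a b] x, 1 / ((k : ℝ) + 1) ≤ dist (f u) (f x)}
  have hE : ∀ k, (E k).Countable := by
    intro k
    refine (countable_setOfPred_isolated_right_within (s := E k)).mono ?_
    intro x hx
    refine ⟨hx, ?_⟩
    obtain ⟨hxab, ⟨d, hd⟩, -⟩ := hx
    have hk : (0 : ℝ) < 1 / ((k : ℝ) + 1) := Nat.one_div_pos_of_nat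
    have hnear := Metric.tendsto_nhds.1 hd _ (half_pos hk)
    rw [nhdsWithin_Ioc_eq_nhdsGT hxab.2] at hnear
    obtain ⟨y, hy, hsub⟩ := (mem_nhdsGT_iff_exists_mem_Ioc_Ioo_subset hxab.2).1 hnear
    refine empty_mem_iff_bot.1 (mem_nhdsWithin.2 ⟨Iio y, isOpen_Iio, hy.1, ?_⟩)
    rintro z ⟨hzy, hz, hxz⟩
    have hzxy : z ∈ Ioo x y := ⟨hxz, hzy⟩
    refine hz.2.2 ?_
    filter_upwards [mem_nhdsWithin_of_mem_nhds (Ioo_mem_nhds hzxy.1 hzxy.2)] with u hu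
    have h1 : dist (f u) d < _ := hsub hu
    have h2 : dist (f z) d < _ := hsub hzxy
    have := dist_triangle_right (f u) (f z) d
    linarith
  refine (countable_iUnion hE).mono ?_
  rintro x ⟨hxab, hlim, hcont⟩
  rw [ContinuousWithinAt, Metric.tendsto_nhds] at hcont
  push Not at hcont
  obtain ⟨ε, hε, hfreq⟩ := hcont
  obtain ⟨k, hk⟩ := exists_nat_one_div_lt hε
  exact mem_iUnion.2 ⟨k, hxab, hlim, hfreq.mono fun u hu => hk.le.trans hu⟩

/-- If `f` is Riemann integrable, then the points whose right neighborhoods all carry an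
oscillation of at least `η` form a null set. -/
lemma RiemannIntegrableOn.volume_rightOscillation_eq_zero {a b : ℝ} (hab : a < b) {f : ℝ → ℝ}
    (hf : RiemannIntegrableOn f a b) {η : ℝ} (hη : 0 < η) :
    volume {x ∈ Ico a b | ∀ y > x, ∃ u ∈ Ioo x y, ∃ v ∈ Ioo x y, η ≤ f u - f v} = 0 := by
  obtain ⟨I, hI⟩ := hf
  suffices h : ∀ ε : ℝ, 0 < ε →
      volume {x ∈ Ico a b | ∀ y > x, ∃ u ∈ Ioo x y, ∃ v ∈ Ioo x y, η ≤ f u - f v}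
        ≤ ENNReal.ofReal ε by
    refine le_antisymm (ENNReal.le_of_forall_pos_le_add fun ε hε _ => ?_) zero_le
    simpa using h ε hε
  intro ε hε
  obtain ⟨δ, hδ, hsum⟩ := hI (ε * η / 2) (by positivity)
  obtain ⟨m, hm⟩ := exists_nat_gt ((b - a) / δ)
  have hba : 0 < b - a := sub_pos.2 hab
  have hm0 : (0 : ℝ) < m := (div_pos hba hδ).trans hm
  let x : ℕ → ℝ := fun i => a + i * ((b - a) / m)
  have hstep : ∀ i, x (i + 1) - x i = (b - a) / m := fun i => by
    simp only [x]; push_cast; ring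
  have hx0 : x 0 = a := by simp [x]
  have hxm : x m = b := by simp only [x]; field_simp; ring
  have hlt : ∀ i, x i < x (i + 1) := fun i => sub_pos.1 ((hstep i).symm ▸ div_pos hba hm0)
  have hmesh : (b - a) / m < δ := by
    rw [div_lt_iff₀ hδ] at hm
    rw [div_lt_iff₀ hm0]
    linarith
  let P : ℕ → Prop := fun i =>
    ∃ p : ℝ × ℝ, p.1 ∈ Icc (x i) (x (i + 1)) ∧ p.2 ∈ Icc (x i) (x (i + 1)) ∧ η ≤ f p.1 - f p.2
  have htags : ∀ i, ∃ p : ℝ × ℝ, p.1 ∈ Icc (x i) (x (i + 1)) ∧ p.2 ∈ Icc (x i) (x (i + 1)) ∧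
      0 ≤ f p.1 - f p.2 ∧ (P i → η ≤ f p.1 - f p.2) := by
    intro i
    by_cases hP : P i
    · obtain ⟨p, h1, h2, h3⟩ := id hP
      exact ⟨p, h1, h2, hη.le.trans h3, fun _ => h3⟩
    · have := left_mem_Icc.2 (hlt i).le
      exact ⟨(x i, x i), this, this, by simp, fun h => absurd h hP⟩
  choose p hp1 hp2 hp0 hpη using htags
  have hn : 0 < m := by exact_mod_cast hm0
  have hS := hsum m x (fun i => (p i).1) hn hx0 hxm (fun i _ => hlt i)
    (fun i _ => (hstep i).trans_lt hmesh) fun i _ => hp1 i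
  have hT := hsum m x (fun i => (p i).2) hn hx0 hxm (fun i _ => hlt i)
    (fun i _ => (hstep i).trans_lt hmesh) fun i _ => hp2 i
  have hdiff : ∑ i ∈ Finset.range m, (f (p i).1 - f (p i).2) * (x (i + 1) - x i) ≤ ε * η := by
    simp only [sub_mul (f _) (f _), Finset.sum_sub_distrib]
    linarith [(abs_lt.1 hS).2, (abs_lt.1 hT).1]
  classical
  have hcover : {x ∈ Ico a b | ∀ y > x, ∃ u ∈ Ioo x y, ∃ v ∈ Ioo x y, η ≤ f u - f v} ⊆
      ⋃ i ∈ (Finset.range m).filter P, Ico (x i) (x (i + 1)) := by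
    rintro z ⟨hz, hosc⟩
    obtain ⟨i, hi, hzi⟩ := exists_mem_Ico_partition (x := x) (n := m) (hx0.trans_le hz.1)
      (hz.2.trans_eq hxm.symm)
    obtain ⟨u, hu, v, hv, huv⟩ := hosc _ hzi.2
    have hsub : Ioo z (x (i + 1)) ⊆ Icc (x i) (x (i + 1)) :=
      (Ioo_subset_Ioo_left hzi.1).trans Ioo_subset_Icc_self
    exact mem_iUnion₂.2 ⟨i, Finset.mem_filter.2 ⟨Finset.mem_range.2 hi,
      (u, v), hsub hu, hsub hv, huv⟩, hzi⟩
  refine (measure_mono hcover).trans ((measure_biUnion_finset_le _ _).trans ?_)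
  simp only [Real.volume_Ico]
  rw [← ENNReal.ofReal_sum_of_nonneg fun i _ => (sub_pos.2 (hlt i)).le]
  refine ENNReal.ofReal_le_ofReal (le_of_mul_le_mul_right ?_ hη)
  calc (∑ i ∈ (Finset.range m).filter P, (x (i + 1) - x i)) * η
      ≤ ∑ i ∈ (Finset.range m).filter P, (f (p i).1 - f (p i).2) * (x (i + 1) - x i) := by
        rw [Finset.sum_mul]
        refine Finset.sum_le_sum fun i hi => ?_
        rw [mul_comm]
        exact mul_le_mul_of_nonneg_right (hpη i (Finset.mem_filter.1 hi).2)
          (sub_pos.2 (hlt i)).le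
    _ ≤ ∑ i ∈ Finset.range m, (f (p i).1 - f (p i).2) * (x (i + 1) - x i) :=
        Finset.sum_le_sum_of_subset_of_nonneg (Finset.filter_subset _ _)
          fun i _ _ => mul_nonneg (hp0 i) (sub_pos.2 (hlt i)).le
    _ ≤ ε * η := hdiff

/-- A real function without a finite right-hand limit at `x` has oscillation bounded below on
right neighborhoods of `x`. -/
lemma exists_rightOscillation_of_not_tendsto {f : ℝ → ℝ} {x : ℝ}
    (h : ¬ ∃ d, Tendsto f (𝓝[>] x) (𝓝 d)) :
    ∃ k : ℕ, ∀ y > x, ∃ u ∈ Ioo x y, ∃ v ∈ Ioo x y, 1 / ((k : ℝ) + 1) ≤ f u - f v := by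
  contrapose! h
  rw [← cauchy_map_iff_exists_tendsto, Metric.cauchy_iff]
  refine ⟨inferInstance, fun ε hε => ?_⟩
  obtain ⟨k, hk⟩ := exists_nat_one_div_lt hε
  obtain ⟨y, hy, hosc⟩ := h k
  refine ⟨f '' Ioo x y, image_mem_map (Ioo_mem_nhdsGT hy), ?_⟩
  rintro _ ⟨u, hu, rfl⟩ _ ⟨v, hv, rfl⟩
  rw [Real.dist_eq, abs_lt]
  constructor <;> linarith [hosc u hu v hv, hosc v hv u hu]

/-- A bounded function `f : [a,b] → ℝ` is Riemann integrable on `[a,b]` iff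
the set of points of `[a,b)` at which `f` does not admit a finite right-hand limit is
Lebesgue-negligible. -/
theorem riemannIntegrable_iff_ae_right_limits (a b : ℝ) (hab : a < b) (f : ℝ → ℝ)
    (hbd : ∃ C : ℝ, ∀ x ∈ Set.Icc a b, |f x| ≤ C) :
    RiemannIntegrableOn f a b ↔
    volume {x ∈ Set.Ico a b |
      ¬ ∃ d : ℝ, Tendsto f (𝓝[Set.Ioc x b] x) (𝓝 d)} = 0 := by
  constructor
  · intro hf
    refine measure_mono_null ?_ (measure_iUnion_null fun k : ℕ =>
      hf.volume_rightOscillation_eq_zero hab (Nat.one_div_pos_of_nat (n := k)))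
    rintro x ⟨hx, hlim⟩
    rw [nhdsWithin_Ioc_eq_nhdsGT hx.2] at hlim
    obtain ⟨k, hk⟩ := exists_rightOscillation_of_not_tendsto hlim
    exact mem_iUnion.2 ⟨k, hx, hk⟩
  · intro hnull
    obtain ⟨C, hC⟩ := hbd
    refine .of_ae_continuousWithinAt hC ((ae_restrict_iff' measurableSet_Ico).2 ?_)
    refine measure_mono_null (fun x hx => ?_) (measure_union_null hnull
      ((countable_rightLimit_not_continuousWithinAt a b f).measure_zero volume))
    obtain ⟨hxab, hcont⟩ := Classical.not_imp.1 hx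
    by_cases hlim : ∃ d, Tendsto f (𝓝[Ioc x b] x) (𝓝 d)
    · exact Or.inr ⟨hxab, hlim, hcont⟩
    · exact Or.inl ⟨hxab, hlim⟩
end

section
/- Let a < b be real numbers and let f : [a,b] → ℝ be a function which is right-hand continuous at every point of [a,b), or left-hand continuous at every point of (a,b]. Then the set of discontinuity points of f is at most countable. -/
open Set Filter MeasureTheory Topology

section

variable {α β : Type*} [LinearOrder α] [TopologicalSpace α] [OrderTopology α]
  [SecondCountableTopology α] [PseudoMetricSpace β]

/-- The points of `s` at which the oscillation of `f` within `s` is at least `ε` form a countable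
set, when `f` is right-continuous within `s` at every point of `s`. -/
theorem countable_large_oscillation_of_continuousWithinAt_Ici {s : Set α} {f : α → β}
    (h : ∀ x ∈ s, ContinuousWithinAt f (s ∩ Ici x) x) {ε : ℝ} (hε : 0 < ε) :
    {x ∈ s | ¬ ∃ U ∈ 𝓝[s] x, ∀ y ∈ U, ∀ z ∈ U, dist (f y) (f z) < ε}.Countable := by
  set D := {x ∈ s | ¬ ∃ U ∈ 𝓝[s] x, ∀ y ∈ U, ∀ z ∈ U, dist (f y) (f z) < ε}
  suffices hiso : ∀ x ∈ D, 𝓝[D ∩ Ioi x] x = ⊥ from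
    (countable_setOfPred_isolated_right_within (s := D)).mono
      fun x hx => mem_sep hx (hiso x hx)
  intro x hx
  obtain ⟨V, hVo, hxV, hV⟩ := mem_nhdsWithin.1
    (h x hx.1 (Metric.ball_mem_nhds (f x) (half_pos hε)))
  have hclose : ∀ y ∈ V ∩ Ioi x ∩ s, dist (f y) (f x) < ε / 2 := fun y hy =>
    hV ⟨hy.1.1, hy.2, le_of_lt hy.1.2⟩
  rw [← empty_mem_iff_bot, mem_nhdsWithin]
  refine ⟨V, hVo, hxV, fun y hy => hy.2.1.2 ⟨V ∩ Ioi x ∩ s, ?_, fun u hu v hv => ?_⟩⟩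
  · exact mem_nhdsWithin.2 ⟨V ∩ Ioi x, hVo.inter isOpen_Ioi, ⟨hy.1, hy.2.2⟩, subset_rfl⟩
  · linarith [dist_triangle_right (f u) (f v) (f x), hclose u hu, hclose v hv]

/-- A function that is right-continuous within `s` at every point of `s` has at most countably many
discontinuity points within `s`. -/
theorem countable_not_continuousWithinAt_of_Ici {s : Set α} {f : α → β}
    (h : ∀ x ∈ s, ContinuousWithinAt f (s ∩ Ici x) x) :
    {x ∈ s | ¬ ContinuousWithinAt f s x}.Countable := by
  refine (countable_iUnion fun n : ℕ => countable_large_oscillation_of_continuousWithinAt_Ici h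
    (Nat.one_div_pos_of_nat (α := ℝ) (n := n))).mono fun x hx => ?_
  by_contra hcon
  rw [mem_iUnion, not_exists] at hcon
  refine hx.2 (Metric.tendsto_nhds.2 fun ε hε => ?_)
  obtain ⟨n, hn⟩ := exists_nat_one_div_lt hε
  obtain ⟨U, hU, hdist⟩ := not_not.1 fun hU => hcon n ⟨hx.1, hU⟩
  filter_upwards [hU] with y hy
  exact (hdist y hy x (mem_of_mem_nhdsWithin hx.1 hU)).trans hn

/-- A function that is left-continuous within `s` at every point of `s` has at most countably many
discontinuity points within `s`. -/
theorem countable_not_continuousWithinAt_of_Iic {s : Set α} {f : α → β}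
    (h : ∀ x ∈ s, ContinuousWithinAt f (s ∩ Iic x) x) :
    {x ∈ s | ¬ ContinuousWithinAt f s x}.Countable :=
  countable_not_continuousWithinAt_of_Ici (α := αᵒᵈ) h

end

/-- If `f : [a,b] → ℝ` is right-hand continuous at every point of `[a,b)`, or
left-hand continuous at every point of `(a,b]`, then the set of discontinuity points of `f`
(relative to `[a,b]`) is at most countable. -/
theorem countable_discontinuities_of_one_sided_continuity (a b : ℝ) (hab : a < b)
    (f : ℝ → ℝ)
    (h : (∀ x ∈ Set.Ico a b, ContinuousWithinAt f (Set.Icc x b) x) ∨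
         (∀ x ∈ Set.Ioc a b, ContinuousWithinAt f (Set.Icc a x) x)) :
    {x ∈ Set.Icc a b | ¬ ContinuousWithinAt f (Set.Icc a b) x}.Countable := by
  rcases h with h | h
  · refine countable_not_continuousWithinAt_of_Ici fun x hx => ?_
    rcases hx.2.lt_or_eq with hxb | rfl
    · exact (h x ⟨hx.1, hxb⟩).mono fun y hy => ⟨hy.2, hy.1.2⟩
    · exact continuousWithinAt_singleton.mono fun y hy => le_antisymm hy.1.2 hy.2
  · refine countable_not_continuousWithinAt_of_Iic fun x hx => ?_
    rcases hx.1.lt_or_eq with hax | rfl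
    · exact (h x ⟨hax, hx.2⟩).mono fun y hy => ⟨hy.1.1, hy.2⟩
    · exact continuousWithinAt_singleton.mono fun y hy => le_antisymm hy.2 hy.1.1
end
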